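/- arXiv:2101.07629 — 3 statements merged into one kernel-verified Lean document; each statement's English description precedes it below -/
import Mathlib

section
/- Let K_1 ⊆ K_2 ⊆ ⋯ ⊆ K_n ⊆ F_q be subfields of the finite field F_q and X = K_1 × ⋯ × K_n. Let p = γ_1 X_1 + ⋯ + γ_h X_h + η ∈ F_q[X_1,…,X_n] with γ_1,…,γ_h ∈ F_q, γ_h ≠ 0, and let j ∈ {1,…,n}. Then there exists φ ∈ Aff(X) such that X_j ∘ φ = p if and only if γ_i ∈ K_j for all i ∈ {1,…,h}, η ∈ K_j, and K_h = K_j. -/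
namespace QACC

open MvPolynomial

noncomputable section

variable {F : Type} [Field F] [Fintype F] [DecidableEq F]

/-- The points of the cartesian set `X = K 0 × ⋯ × K (n-1)`, as a subtype. -/
abbrev cartPoint {n : ℕ} (K : Fin n → Set F) : Type _ :=
  {α : Fin n → F // ∀ i, α i ∈ K i}

noncomputable instance {n : ℕ} (K : Fin n → Set F) : Fintype (cartPoint K) :=
  Fintype.ofFinite _

/-- The evaluation linear map `Ψ` sending a polynomial to its vector of values at points of X. -/
def evalX {n : ℕ} (K : Fin n → Set F) :
    MvPolynomial (Fin n) F →ₗ[F] (cartPoint K → F) where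
  toFun f := fun x => eval x.1 f
  map_add' f g := by funext x; simp
  map_smul' c f := by funext x; simp

/-- The affine cartesian code `C_X(d)`: evaluations of polynomials of total degree `≤ d`. -/
def cartCode {n : ℕ} (K : Fin n → Set F) (d : ℕ) : Submodule F (cartPoint K → F) :=
  (restrictTotalDegree (Fin n) F d).map (evalX K)

/-- The space `P_d^{(δ,s)}` of polynomials of total degree `≤ d` with degree in `X s`
at most `|K s| - δ`. -/
def quasiPoly (n : ℕ) (K : Fin n → Set F) (d δ : ℕ) (s : Fin n) :
    Submodule F (MvPolynomial (Fin n) F) where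
  carrier := {f | f.totalDegree ≤ d ∧ f.degreeOf s ≤ (K s).ncard - δ}
  zero_mem' := by simp
  add_mem' := by
    rintro f g ⟨hf1, hf2⟩ ⟨hg1, hg2⟩
    exact ⟨le_trans (totalDegree_add f g) (max_le hf1 hg1),
      le_trans (degreeOf_add_le s f g) (max_le hf2 hg2)⟩
  smul_mem' := by
    rintro c f ⟨hf1, hf2⟩
    refine ⟨le_trans (totalDegree_smul_le c f) hf1, ?_⟩
    calc (c • f).degreeOf s = (C c * f).degreeOf s := by rw [smul_eq_C_mul]
      _ ≤ (C c).degreeOf s + f.degreeOf s := degreeOf_mul_le s (C c) f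
      _ ≤ (K s).ncard - δ := by simpa [degreeOf_C] using hf2

/-- The `(δ,s)`-quasi affine cartesian code `D_X^{(δ,s)}(d)`. -/
def quasiCode {n : ℕ} (K : Fin n → Set F) (d δ : ℕ) (s : Fin n) :
    Submodule F (cartPoint K → F) :=
  (quasiPoly n K d δ s).map (evalX K)

/-- The minimum distance (minimum Hamming weight of a nonzero codeword) of a linear code. -/
def minDist {ι : Type} [Fintype ι] (C : Submodule F (ι → F)) : ℕ :=
  sInf {w | ∃ v ∈ C, v ≠ 0 ∧ hammingNorm v = w}


/-- Two affine polynomials are equal iff their coefficients are. -/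
theorem affine_eq_iff {E : Type*} [Field E] {n : ℕ} (c d : Fin n → E) (a b : E) :
    (∑ w, C (c w) * (X w : MvPolynomial (Fin n) E)) + C a
        = (∑ w, C (d w) * (X w : MvPolynomial (Fin n) E)) + C b ↔ c = d ∧ a = b := by
  constructor
  · intro e
    have ev : ∀ x : Fin n → E, ∑ w, c w * x w + a = ∑ w, d w * x w + b := fun x => by
      simpa using congrArg (eval x) e
    have hab : a = b := by simpa using ev 0
    subst hab
    refine ⟨funext fun i => ?_, rfl⟩
    simpa [Pi.single_apply] using ev (Pi.single i 1)
  · rintro ⟨rfl, rfl⟩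
    rfl

/-- If `α ↦ Aα + b` maps `∏ K i` into itself, then `b` lies in the product and multiplication
by `A i w` sends `K w` into `K i`. -/
theorem mem_of_mapsTo_affine {E : Type*} [Field E] {n : ℕ} {K : Fin n → Subfield E}
    {A : Matrix (Fin n) (Fin n) E} {b : Fin n → E}
    (hA : ∀ α : Fin n → E, (∀ i, α i ∈ K i) → ∀ i, (A.mulVec α + b) i ∈ K i) :
    (∀ i, b i ∈ K i) ∧ ∀ i w, ∀ c ∈ K w, A i w * c ∈ K i := by
  have hb : ∀ i, b i ∈ K i := fun i => by simpa using hA 0 (fun i => (K i).zero_mem) i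
  refine ⟨hb, fun i w c hc => ?_⟩
  have hs := hA (Pi.single w c) (fun k => ?_) i
  · simpa [mul_comm] using (K i).sub_mem hs (hb i)
  · rcases eq_or_ne k w with rfl | hk
    · simpa using hc
    · simp [hk]

/-- If multiplication by a nonzero element sends a subfield `K` into a subfield `L`,
then `K ≤ L`. -/
theorem le_of_mul_mem {E : Type*} [Field E] {K L : Subfield E} {a : E} (ha : a ≠ 0)
    (h : ∀ c ∈ K, a * c ∈ L) : K ≤ L := by
  intro c hc
  have h1 : a ∈ L := by simpa using h 1 K.one_mem
  simpa [ha] using L.mul_mem (L.inv_mem h1) (h c hc)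

/-- An invertible matrix over a finite field which is zero on `B × Bᶜ` has no row outside `B`
vanishing on `Bᶜ`. -/
theorem exists_ne_zero_of_isUnit_det {E : Type*} [Field E] [Finite E] {n : ℕ}
    {A : Matrix (Fin n) (Fin n) E} (hA : IsUnit A.det) (B : Set (Fin n)) (hB : ∀ i ∈ B, ∀ w ∉ B, A i w = 0)
    {j : Fin n} (hj : j ∉ B) : ∃ w ∉ B, A j w ≠ 0 := by
  by_contra! hrow
  have hinj : Function.Injective A.mulVec :=
    Matrix.mulVec_injective_of_isUnit ((Matrix.isUnit_iff_isUnit_det A).2 hA)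
  let S : Set (Fin n → E) := {v | ∀ w ∈ B, v w = 0}
  have hvanish : ∀ i, (∀ w ∉ B, A i w = 0) → ∀ v ∈ S, A.mulVec v i = 0 := by
    intro i hi v hv
    rw [Matrix.mulVec, dotProduct]
    refine Finset.sum_eq_zero fun w _ => ?_
    by_cases hw : w ∈ B
    · simp [hv w hw]
    · simp [hi w hw]
  have hmaps : Set.MapsTo A.mulVec S S := fun v hv i hi => hvanish i (hB i hi) v hv
  have hsurj : Set.SurjOn A.mulVec S S :=
    ((Set.toFinite S).injOn_iff_bijOn_of_mapsTo hmaps).1 hinj.injOn |>.surjOn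
  obtain ⟨v, hv, hvj⟩ := hsurj (show Pi.single j 1 ∈ S from fun w hw => by
    simp [show w ≠ j from fun e => hj (e ▸ hw)])
  simpa [hvj] using hvanish j hrow v hv

/-- for a chain of subfields K_1 ⊆ ⋯ ⊆ K_n and a degree-one polynomial
p = γ_1 X_1 + ⋯ + γ_h X_h + η with γ_h ≠ 0, there is an element φ of Aff(X)
(given by an invertible affine map ψ : α ↦ Aα + b with ψ(X) = X) with X_j ∘ φ = p
iff all γ_i ∈ K_j, η ∈ K_j and K_h = K_j.  Here X_j ∘ φ is the polynomial
∑_w (A j w) X_w + b j. -/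
theorem exists_affine_with_Xj_comp_eq_iff
    (n : ℕ) (K : Fin n → Subfield F) (hmono : Monotone K)
    (h : Fin n) (γ : Fin n → F) (η : F) (hγh : γ h ≠ 0) (hsupp : ∀ i, h < i → γ i = 0)
    (j : Fin n) :
    (∃ (A : Matrix (Fin n) (Fin n) F) (b : Fin n → F), IsUnit A.det ∧
        (fun α => A.mulVec α + b) '' {α : Fin n → F | ∀ i, α i ∈ K i}
          = {α : Fin n → F | ∀ i, α i ∈ K i} ∧
        (∑ w, C (A j w) * (X w : MvPolynomial (Fin n) F)) + C (b j)
          = (∑ w, C (γ w) * (X w : MvPolynomial (Fin n) F)) + C η) ↔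
    ((∀ i, γ i ∈ K j) ∧ η ∈ K j ∧ K h = K j) := by
  simp only [affine_eq_iff]
  constructor
  · rintro ⟨A, b, hdet, himg, hrow, hbj⟩
    obtain ⟨hb, hmul⟩ := mem_of_mapsTo_affine (K := K) (A := A) (b := b)
      fun α hα => himg.subset (Set.mem_image_of_mem _ hα)
    have hle : ∀ i w, A i w ≠ 0 → K w ≤ K i := fun i w hiw => le_of_mul_mem hiw (hmul i w)
    have hhj : K h ≤ K j := hle j h (by rwa [hrow])
    refine ⟨fun i => ?_, hbj ▸ hb j, hhj.antisymm ?_⟩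
    · simpa [hrow] using hmul j i 1 (K i).one_mem
    · obtain ⟨w, hw, hjw⟩ := exists_ne_zero_of_isUnit_det hdet {i | ¬ K j ≤ K i}
        (fun i hi w hw => by_contra fun hne => hi ((not_not.1 hw).trans (hle i w hne)))
        (j := j) (by simp)
      have hwh : w ≤ h := by
        by_contra! hlt
        exact hjw (by rw [hrow, hsupp w hlt])
      exact (not_not.1 hw).trans (hmono hwh)
  · rintro ⟨hγ, hη, hK⟩
    let A : Matrix (Fin n) (Fin n) F :=
      ((1 : Matrix (Fin n) (Fin n) F).updateRow h γ).submatrix (Equiv.swap h j) id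
    have hAj : A j = γ := by
      funext w
      simp [A]
    have hdet : IsUnit A.det := by
      have hup : ((1 : Matrix (Fin n) (Fin n) F).updateRow h γ).det = γ h := by
        rw [← Matrix.cramer_transpose_apply]
        simp
      rw [Matrix.det_permute, hup]
      exact ((Equiv.Perm.sign (Equiv.swap h j)).isUnit.map (Int.castRingHom F)).mul
        (isUnit_iff_ne_zero.2 hγh)
    have hinj : Function.Injective fun α => A.mulVec α + Pi.single j η :=
      (add_left_injective _).comp
        (Matrix.mulVec_injective_of_isUnit ((Matrix.isUnit_iff_isUnit_det A).2 hdet))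
    refine ⟨A, Pi.single j η, hdet, ?_, hAj, by simp⟩
    have hmaps : Set.MapsTo (fun α => A.mulVec α + Pi.single j η)
        {α : Fin n → F | ∀ i, α i ∈ K i} {α : Fin n → F | ∀ i, α i ∈ K i} := by
      intro α hα i
      rcases eq_or_ne i j with rfl | hij
      · have hsum : ∑ w, γ w * α w ∈ K i := by
          refine (K i).sum_mem fun w _ => ?_
          rcases le_or_gt w h with hw | hw
          · exact (K i).mul_mem (hγ w) (hK ▸ hmono hw (hα w))
          · simp [hsupp w hw]
        simpa [Matrix.mulVec, dotProduct, hAj] using (K i).add_mem hsum hη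
      · have hi : A.mulVec α i = α (Equiv.swap h j i) := by
          have hne : Equiv.swap h j i ≠ h := fun e => hij (by
            simpa using (Equiv.swap h j).injective (e.trans (Equiv.swap_apply_right h j).symm))
          simp [A, Matrix.mulVec, dotProduct, Matrix.updateRow_ne hne, Matrix.one_apply]
        have hKi : K (Equiv.swap h j i) = K i := by
          rcases eq_or_ne i h with rfl | hih
          · simp [hK]
          · rw [Equiv.swap_apply_of_ne_of_ne hih hij]
        simpa [hi, hij, hKi] using hα (Equiv.swap h j i)
    exact (((Set.toFinite _).injOn_iff_bijOn_of_mapsTo hmaps).1 hinj.injOn).image_eq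

end
end QACC
end

section
/- Let K_1 ⊆ K_2 ⊆ ⋯ ⊆ K_n ⊆ F_q be subfields of F_q with |K_i| = d_i, and X = K_1 × ⋯ × K_n. Let f ∈ F_q[X_1,…,X_n] be a polynomial of degree d = ∑_{i=1}^k (d_i − 1) + ℓ, where 0 ≤ k < n and 0 < ℓ ≤ d_{k+1} − 1, such that no monomial appearing in f is a multiple of X_i^{d_i} for any i ∈ {1,…,n}. If the Hamming weight of Ψ(f) equals (d_{k+1} − ℓ)·∏_{i=k+2}^n d_i, then there exist j ∈ {1,…,k+1} with d_j ≥ d_{k+1} − ℓ and distinct indices t_1,…,t_{k+1} ∈ {1,…,n} with K_{t_i} = K_i for all i ∈ {1,…,k+1}, such that the monomial X_{t_j}^{d_j − (d_{k+1} − ℓ)} · ∏_{i ∈ {1,…,k+1}, i ≠ j} X_{t_i}^{d_i − 1} appears (with nonzero coefficient) in f. -/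
namespace QACC

open MvPolynomial

noncomputable section

variable {F : Type} [Field F] [Fintype F] [DecidableEq F]

/-- The footprint bound: a polynomial whose degree-lexicographic leading exponent `a` satisfies
`a i < #(S i)` is nonzero on at least `∏ i, (#(S i) - a i)` points of the grid `∏ i, S i`. -/
theorem footprint_bound {R : Type*} [Field R] [DecidableEq R] {n : ℕ} (S : Fin n → Finset R)
    (f : MvPolynomial (Fin n) R) (hf : f ≠ 0)
    (ha : ∀ i, MonomialOrder.degLex.degree f i < (S i).card) :
    ∏ i, ((S i).card - MonomialOrder.degLex.degree f i) ≤
      ((Fintype.piFinset S).filter (fun x => eval x f ≠ 0)).card := by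
  set a := MonomialOrder.degLex.degree f with ha_def
  set T := (Fintype.piFinset S).filter (fun x => eval x f ≠ 0) with hT
  by_contra! hlt
  let V := ∀ i, Fin ((S i).card - a i)
  let e : V → (Fin n →₀ ℕ) := fun v => Finsupp.equivFunOnFinite.symm (fun i => (v i : ℕ))
  have he : Function.Injective e := by
    intro v w hvw
    funext i
    exact Fin.ext (by simpa [e] using DFunLike.congr_fun hvw i)
  let P : (V → R) →ₗ[R] MvPolynomial (Fin n) R :=
    ∑ v, (monomial (e v)).comp (LinearMap.proj v)
  have hP : ∀ c, P c = ∑ v, monomial (e v) (c v) := fun c => by simp [P]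
  have hcoeff : ∀ c v, coeff (e v) (P c) = c v := by
    intro c v
    rw [hP, coeff_sum, Finset.sum_eq_single v]
    · simp
    · intro w _ hw
      rw [coeff_monomial, if_neg (fun h => hw (he h))]
    · simp
  let L : (V → R) →ₗ[R] (T → R) :=
    LinearMap.pi (fun x => (aeval (R := R) (x : Fin n → R)).toLinearMap.comp P)
  have hker : LinearMap.ker L ≠ ⊥ := by
    apply L.ker_ne_bot_of_finrank_lt
    simpa [V] using hlt
  obtain ⟨c, hc, hc0⟩ := (Submodule.ne_bot_iff _).1 hker
  have hvan : ∀ x ∈ T, eval x (P c) = 0 := by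
    intro x hx
    have := congrFun (LinearMap.mem_ker.1 hc) ⟨x, hx⟩
    simpa [L, aeval_eq_eval] using this
  have hne : P c ≠ 0 := by
    intro h
    exact hc0 (funext fun v => by rw [← hcoeff c v, h]; simp)
  obtain ⟨v, hv⟩ : ∃ v, e v = MonomialOrder.degLex.degree (P c) := by
    by_contra! hno
    have := (mem_support_iff.1 (MonomialOrder.degLex.degree_mem_support hne))
    apply this
    rw [hP c, coeff_sum]
    refine Finset.sum_eq_zero fun w _ => ?_
    rw [coeff_monomial, if_neg]
    rw [← hP]
    exact hno w
  have hmul : P c * f ≠ 0 := mul_ne_zero hne hf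
  obtain ⟨x, hx, hxe⟩ := combinatorial_nullstellensatz_exists_eval_nonzero (P c * f)
    (MonomialOrder.degLex.degree (P c * f))
    (mem_support_iff.1 (MonomialOrder.degLex.degree_mem_support hmul))
    degree_degLexDegree.symm S (by
      intro i
      rw [MonomialOrder.degree_mul hne hf, ← hv, ← ha_def]
      have h1 := (v i).2
      have h2 := ha i
      have h3 : e v i = (v i : ℕ) := by simp [e]
      rw [Finsupp.add_apply, h3]
      omega)
  rw [map_mul] at hxe
  refine left_ne_zero_of_mul hxe (hvan x ?_)
  rw [hT, Finset.mem_filter, Fintype.mem_piFinset]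
  exact ⟨hx, right_ne_zero_of_mul hxe⟩

/-- If `b ≤ D` pointwise and `D` is monotone, then the increasing rearrangement of `b` is still
bounded by `D`. -/
theorem comp_sort_le {n : ℕ} {D b : Fin n → ℕ} (hD : Monotone D) (hb : ∀ i, b i ≤ D i)
    (i : Fin n) : b (Tuple.sort b i) ≤ D i := by
  by_contra! hlt
  have hsub : (Finset.Ici i).map (Tuple.sort b).toEmbedding ⊆ Finset.Ioi i := by
    intro x hx
    obtain ⟨y, hy, rfl⟩ := Finset.mem_map.1 hx
    rw [Finset.mem_Ioi]
    by_contra! hle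
    have h1 : b (Tuple.sort b i) ≤ b (Tuple.sort b y) :=
      Tuple.monotone_sort b (Finset.mem_Ici.1 hy)
    have h2 := hb (Tuple.sort b y)
    have h3 : D (Tuple.sort b y) ≤ D i := hD hle
    omega
  have := Finset.card_le_card hsub
  rw [Finset.card_map, Fin.card_Ici, Fin.card_Ioi] at this
  have := i.2
  omega

/-- Moving a unit from a smaller entry to a larger one preserves the sum and decreases the
product. -/
theorem exists_transfer {ι : Type*} [Fintype ι] [DecidableEq ι] {D b : ι → ℕ}
    (hb1 : ∀ i, 1 ≤ b i) (hbD : ∀ i, b i ≤ D i) {i j : ι} (hij : i ≠ j)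
    (hi : b i < D i) (hj : 2 ≤ b j) (hle : b j ≤ b i) :
    ∃ b' : ι → ℕ, (∀ i, 1 ≤ b' i) ∧ (∀ i, b' i ≤ D i) ∧ ∑ i, b' i = ∑ i, b i ∧
      ∏ i, b' i < ∏ i, b i := by
  let b' := Function.update (Function.update b i (b i + 1)) j (b j - 1)
  have hbi : b' i = b i + 1 := by simp [b', hij]
  have hbj : b' j = b j - 1 := by simp [b']
  have hother : ∀ x, x ≠ i → x ≠ j → b' x = b x := by
    intro x hxi hxj
    simp [b', hxi, hxj]
  have hj' : j ∈ Finset.univ.erase i := by simp [hij.symm]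
  refine ⟨b', fun x => ?_, fun x => ?_, ?_, ?_⟩
  · by_cases hxi : x = i
    · subst hxi; omega
    by_cases hxj : x = j
    · subst hxj; omega
    rw [hother x hxi hxj]; exact hb1 x
  · by_cases hxi : x = i
    · subst hxi; omega
    by_cases hxj : x = j
    · subst hxj; have := hbD x; omega
    rw [hother x hxi hxj]; exact hbD x
  · have hrest : ∑ x ∈ (Finset.univ.erase i).erase j, b' x =
        ∑ x ∈ (Finset.univ.erase i).erase j, b x :=
      Finset.sum_congr rfl fun x hx => by
        simp only [Finset.mem_erase] at hx
        exact hother x hx.2.1 hx.1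
    rw [← Finset.add_sum_erase _ _ (Finset.mem_univ i), ← Finset.add_sum_erase _ _ hj',
      ← Finset.add_sum_erase _ b (Finset.mem_univ i), ← Finset.add_sum_erase _ b hj', hrest]
    omega
  · have hrest : ∏ x ∈ (Finset.univ.erase i).erase j, b' x =
        ∏ x ∈ (Finset.univ.erase i).erase j, b x :=
      Finset.prod_congr rfl fun x hx => by
        simp only [Finset.mem_erase] at hx
        exact hother x hx.2.1 hx.1
    rw [← Finset.mul_prod_erase _ _ (Finset.mem_univ i), ← Finset.mul_prod_erase _ _ hj',
      ← Finset.mul_prod_erase _ b (Finset.mem_univ i), ← Finset.mul_prod_erase _ b hj', hrest,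
      ← mul_assoc, ← mul_assoc, hbi, hbj]
    refine Nat.mul_lt_mul_of_pos_right ?_ (Finset.prod_pos fun x _ => hb1 x)
    obtain ⟨y, hy⟩ := Nat.exists_eq_add_of_le hj
    rw [hy] at hle ⊢
    have : 2 + y - 1 = y + 1 := by omega
    rw [this]
    nlinarith

/-- Among vectors `b` with `1 ≤ b ≤ D` (`D` monotone) and prescribed sum, those of least product
are rearrangements of the vector that is `1` before `k`, equals `c` at `k` and `D` after `k`. -/
theorem exists_perm_of_prod_le {n : ℕ} {D : Fin n → ℕ} (hD : Monotone D) (k : Fin n) {c : ℕ}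
    (hc1 : 1 ≤ c) (hcD : c ≤ D k) {e : Fin n → ℕ}
    (he : ∀ i, e i = if i < k then 1 else if i = k then c else D i)
    (b : Fin n → ℕ) (hb1 : ∀ i, 1 ≤ b i) (hbD : ∀ i, b i ≤ D i)
    (hsum : ∑ i, b i = ∑ i, e i) (hprod : ∏ i, b i ≤ ∏ i, e i) :
    ∃ σ : Equiv.Perm (Fin n), ∀ i, b (σ i) = e i := by
  induction hN : ∏ i, b i using Nat.strong_induction_on generalizing b with
  | _ N ih =>
  let s : Fin n → ℕ := fun i => b (Tuple.sort b i)
  have hs1 : ∀ i, 1 ≤ s i := fun i => hb1 _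
  have hsD : ∀ i, s i ≤ D i := comp_sort_le hD hbD
  have hsmono : Monotone s := Tuple.monotone_sort b
  have hssum : ∑ i, s i = ∑ i, e i := by rw [← hsum]; exact Equiv.sum_comp _ b
  have hsprod : ∏ i, s i = ∏ i, b i := Equiv.prod_comp _ b
  have hE : ∀ j, 2 ≤ s j → ∀ i, j < i → s i = D i := by
    intro j hj i hji
    by_contra hne
    obtain ⟨b', h1, h2, h3, h4⟩ := exists_transfer hs1 hsD hji.ne'
      (lt_of_le_of_ne (hsD i) hne) hj (hsmono hji.le)
    obtain ⟨σ, hσ⟩ := ih (∏ i, b' i) (by omega) b' h1 h2 (by omega) (by omega) rfl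
    have : ∏ i, b' i = ∏ i, e i := by
      rw [← Equiv.prod_comp σ]
      exact Finset.prod_congr rfl fun i _ => hσ i
    omega
  have heD : ∀ i, e i ≤ D i := by
    intro i
    rw [he]
    split_ifs with h h'
    · exact (hs1 i).trans (hsD i)
    · rw [h']; exact hcD
    · exact le_rfl
  have hle : ∀ i, s i ≤ e i := by
    intro j
    by_contra! hlt
    have hj2 : 2 ≤ s j := by
      have : 1 ≤ e j := by
        rw [he]
        split_ifs
        · exact le_rfl
        · exact hc1
        · exact (hs1 j).trans (hsD j)
      omega
    have hjk : j ≤ k := by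
      by_contra! h
      rw [he, if_neg h.not_gt, if_neg h.ne'] at hlt
      have := hsD j
      omega
    have : ∑ i, e i < ∑ i, s i := by
      refine Finset.sum_lt_sum (fun i _ => ?_) ⟨j, Finset.mem_univ j, hlt⟩
      rcases lt_trichotomy i j with h | h | h
      · rw [he, if_pos (by order)]
        exact hs1 i
      · rw [h]; exact hlt.le
      · rw [hE j hj2 i h]; exact heD i
    omega
  exact ⟨Tuple.sort b, fun i =>
    (Finset.sum_eq_sum_iff_of_le fun i _ => hle i).1 hssum i (Finset.mem_univ i)⟩

/-- The `i`-th element of a finite subset of `Fin n` is at least `i`. -/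
theorem castLE_le_orderEmbOfFin {n m : ℕ} (h : m ≤ n) (s : Finset (Fin n)) (hs : s.card = m)
    (i : Fin m) : Fin.castLE h i ≤ s.orderEmbOfFin hs i := by
  obtain ⟨i, hi⟩ := i
  rw [Fin.le_def]
  simp only [Fin.val_castLE]
  induction i with
  | zero => exact Nat.zero_le _
  | succ i ih =>
    have h1 := ih (by omega)
    have h2 : s.orderEmbOfFin hs ⟨i, by omega⟩ < s.orderEmbOfFin hs ⟨i + 1, hi⟩ :=
      (s.orderEmbOfFin hs).strictMono (by simp [Fin.lt_def])
    rw [Fin.lt_def] at h2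
    omega

/-- A permutation `σ` with `D x ≤ D (σ x)` for all `x > k`, with `D` monotone, preserves `D` on
those `x`, and the image under `σ` of the remaining indices, listed in increasing order, has the
same `D`-values as the initial segment. -/
theorem exists_orderEmb_of_le_perm {n : ℕ} {D : Fin n → ℕ} (hD : Monotone D) {k : ℕ} (hk : k < n)
    (σ : Equiv.Perm (Fin n)) (hσ : ∀ x, ⟨k, hk⟩ < x → D x ≤ D (σ x)) :
    ∃ t : Fin (k + 1) ↪o Fin n, (∀ i, Fin.castLE hk i ≤ t i) ∧
      (∀ i, D (t i) = D (Fin.castLE hk i)) ∧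
      (∀ y, (∃ i, t i = y) ↔ ∃ x ≤ ⟨k, hk⟩, σ x = y) ∧
      ∀ x, ⟨k, hk⟩ < x → D (σ x) = D x := by
  let R := (Finset.Iic (⟨k, hk⟩ : Fin n)).map σ.toEmbedding
  have hR : R.card = k + 1 := by simp [R]
  let t := R.orderEmbOfFin hR
  have hle : ∀ i, Fin.castLE hk i ≤ t i := castLE_le_orderEmbOfFin hk R hR
  have hmem : ∀ y, (∃ i, t i = y) ↔ ∃ x ≤ ⟨k, hk⟩, σ x = y := by
    intro y
    have : y ∈ Set.range t ↔ y ∈ R := by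
      rw [Finset.range_orderEmbOfFin R hR, Finset.mem_coe]
    rw [← Set.mem_range, this]
    simp only [R, Finset.mem_map, Finset.mem_Iic, Equiv.coe_toEmbedding]
  have hsumt : ∑ i, D (t i) = ∑ x ∈ Finset.Iic (⟨k, hk⟩ : Fin n), D (σ x) := by
    have h1 : R = Finset.univ.map t.toEmbedding := by
      ext y
      simp only [R, Finset.mem_map, Finset.mem_Iic, Equiv.coe_toEmbedding, Finset.mem_univ,
        true_and, RelEmbedding.coe_toEmbedding]
      exact (hmem y).symm
    have h2 : ∑ y ∈ R, D y = ∑ x ∈ Finset.Iic (⟨k, hk⟩ : Fin n), D (σ x) := by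
      simp [R]
    rw [← h2, h1, Finset.sum_map]
    rfl
  have hsumc : ∑ i, D (Fin.castLE hk i) = ∑ x ∈ Finset.Iic (⟨k, hk⟩ : Fin n), D x := by
    have h1 : Finset.Iic (⟨k, hk⟩ : Fin n) = Finset.univ.map (Fin.castLEEmb hk) := by
      ext y
      simp only [Finset.mem_Iic, Finset.mem_map, Finset.mem_univ, true_and, Fin.le_def]
      constructor
      · intro h
        exact ⟨⟨y, Nat.lt_succ_of_le h⟩, rfl⟩
      · rintro ⟨i, rfl⟩
        exact Nat.le_of_lt_succ i.2
    rw [h1, Finset.sum_map]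
    rfl
  have hcompl : (Finset.Iic (⟨k, hk⟩ : Fin n))ᶜ = Finset.Ioi ⟨k, hk⟩ := by
    ext y; simp
  have htot1 := Finset.sum_add_sum_compl (Finset.Iic (⟨k, hk⟩ : Fin n)) D
  have htot2 := Finset.sum_add_sum_compl (Finset.Iic (⟨k, hk⟩ : Fin n)) (fun x => D (σ x))
  rw [hcompl] at htot1 htot2
  rw [Equiv.sum_comp σ D] at htot2
  have hhi : ∀ x ∈ Finset.Ioi (⟨k, hk⟩ : Fin n), D x ≤ D (σ x) :=
    fun x hx => hσ x (Finset.mem_Ioi.1 hx)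
  have hlo : ∀ i ∈ Finset.univ, D (Fin.castLE hk i) ≤ D (t i) := fun i _ => hD (hle i)
  have h1 := Finset.sum_le_sum hhi
  have h2 := Finset.sum_le_sum hlo
  rw [hsumt, hsumc] at h2
  refine ⟨t, hle, fun i => ?_, hmem, fun x hx => ?_⟩
  · exact ((Finset.sum_eq_sum_iff_of_le hlo).1 (by rw [hsumt, hsumc]; omega) i (Finset.mem_univ i)).symm
  · exact ((Finset.sum_eq_sum_iff_of_le hhi).1 (by omega) x (Finset.mem_Ioi.2 hx)).symm

/-- The Hamming weight of an evaluation vector, counted on the ambient grid. -/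
theorem hammingNorm_evalX {n : ℕ} (K : Fin n → Set F) (f : MvPolynomial (Fin n) F) :
    hammingNorm (evalX K f) =
      ((Fintype.piFinset fun i => (Set.toFinite (K i)).toFinset).filter
        (fun x => eval x f ≠ 0)).card := by
  rw [hammingNorm, ← Finset.card_map (Function.Embedding.subtype _)]
  congr 1
  ext x
  simp only [Finset.mem_map, Finset.mem_filter, Finset.mem_univ, true_and,
    Fintype.mem_piFinset, Set.Finite.mem_toFinset]
  constructor
  · rintro ⟨y, hy, rfl⟩
    exact ⟨y.2, hy⟩
  · rintro ⟨hx, hne⟩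
    exact ⟨⟨x, hx⟩, hne, rfl⟩

/-- if f has degree d = ∑_{i=1}^k (d_i - 1) + ℓ, no monomial of f is a
multiple of any X_i^{d_i}, and Ψ(f) has minimal weight (d_{k+1} - ℓ)∏_{i=k+2}^n d_i, then
f contains a monomial X_{t_j}^{d_j - (d_{k+1} - ℓ)} ∏_{i ≠ j} X_{t_i}^{d_i - 1} with the
t_i distinct and K_{t_i} = K_i.  (0-based indices: j and the t_i range over Fin (k+1),
d_{k+1} is the card of K ⟨k⟩.) -/
theorem minimal_weight_monomial
    (n : ℕ) (K : Fin n → Subfield F) (hmono : Monotone K)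
    (d k ℓ : ℕ) (hk : k < n) (hℓ1 : 0 < ℓ) (hℓ2 : ℓ ≤ ((K ⟨k, hk⟩ : Set F)).ncard - 1)
    (hd : d = (∑ i ∈ Finset.univ.filter (fun i : Fin n => (i : ℕ) < k),
        (((K i : Set F)).ncard - 1)) + ℓ)
    (f : MvPolynomial (Fin n) F) (hdeg : f.totalDegree = d)
    (hmon : ∀ m ∈ f.support, ∀ i, m i < ((K i : Set F)).ncard)
    (hw : hammingNorm (evalX (fun i => (K i : Set F)) f) =
        (((K ⟨k, hk⟩ : Set F)).ncard - ℓ) *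
          ∏ i ∈ Finset.univ.filter (fun i : Fin n => k + 1 ≤ (i : ℕ)),
            ((K i : Set F)).ncard) :
    ∃ (j : Fin (k + 1)) (t : Fin (k + 1) → Fin n), Function.Injective t ∧
      (∀ i : Fin (k + 1), K (t i) = K (Fin.castLE hk i)) ∧
      ((K ⟨k, hk⟩ : Set F)).ncard - ℓ ≤ ((K (Fin.castLE hk j) : Set F)).ncard ∧
      ∃ m₀ ∈ f.support,
        m₀ (t j) = ((K (Fin.castLE hk j) : Set F)).ncard
            - (((K ⟨k, hk⟩ : Set F)).ncard - ℓ) ∧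
        (∀ i : Fin (k + 1), i ≠ j →
          m₀ (t i) = ((K (Fin.castLE hk i) : Set F)).ncard - 1) ∧
        (∀ w : Fin n, (∀ i, t i ≠ w) → m₀ w = 0) := by
  set D : Fin n → ℕ := fun i => ((K i : Set F)).ncard with hD_def
  have hDmono : Monotone D := fun i j hij =>
    Set.ncard_le_ncard (hmono hij) (Set.toFinite _)
  have hKeq : ∀ i j, i ≤ j → D j = D i → K j = K i := fun i j hij h =>
    SetLike.coe_injective
      (Set.eq_of_subset_of_ncard_le (hmono hij) h.le (Set.toFinite _)).symm
  have hf : f ≠ 0 := by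
    rintro rfl
    rw [totalDegree_zero] at hdeg
    omega
  set a := MonomialOrder.degLex.degree f with ha_def
  have ha_mem : a ∈ f.support := MonomialOrder.degLex.degree_mem_support hf
  have ha : ∀ i, a i < D i := hmon a ha_mem
  have hasum : ∑ i, a i = d := by
    rw [← hdeg, ← degree_degLexDegree, Finsupp.degree_eq_sum]
  set κ : Fin n := ⟨k, hk⟩ with hκ
  set c := D κ - ℓ with hc
  change ℓ ≤ D κ - 1 at hℓ2
  have hκpos := ha κ
  let e : Fin n → ℕ := fun i => if i < κ then 1 else if i = κ then c else D i
  have hesum : ∑ i, e i + d = ∑ i, D i := by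
    have hd' : d = ∑ i, ((if i < κ then D i - 1 else 0) + if i = κ then ℓ else 0) := by
      rw [hd, Finset.sum_add_distrib, Finset.sum_filter, Finset.sum_ite_eq' Finset.univ κ,
        if_pos (Finset.mem_univ κ)]
      simp [hκ, Fin.lt_def, hD_def]
    rw [hd', ← Finset.sum_add_distrib]
    refine Finset.sum_congr rfl fun i _ => ?_
    have := ha i
    rcases lt_trichotomy i κ with h | h | h
    · simp only [e, if_pos h, if_neg h.ne]
      omega
    · simp only [e, h, lt_irrefl, if_false, if_true]
      omega
    · simp [e, h.ne', h.not_gt]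
  have heprod : ∏ i, e i = c * ∏ i ∈ Finset.univ.filter (fun i : Fin n => k + 1 ≤ (i : ℕ)), D i := by
    rw [Finset.prod_filter, ← Fintype.prod_ite_eq' κ (fun _ => c), ← Finset.prod_mul_distrib]
    refine Finset.prod_congr rfl fun i _ => ?_
    rcases lt_trichotomy i κ with h | h | h
    · have h' : ¬ k + 1 ≤ (i : ℕ) := by rw [Fin.lt_def] at h; simp only [hκ] at h; omega
      simp [e, h, h.ne, h']
    · have h' : ¬ k + 1 ≤ (i : ℕ) := by rw [h]; simp [hκ]
      simp only [if_neg h']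
      simp [e, h]
    · have h' : k + 1 ≤ (i : ℕ) := h
      simp [e, h.ne', h.not_gt, h']
  have hfoot : ∏ i, (D i - a i) ≤ ∏ i, e i := by
    have hcard : ∀ i, ((Set.toFinite (K i : Set F)).toFinset).card = D i := fun i =>
      (Set.ncard_eq_toFinset_card _ _).symm
    have := footprint_bound (fun i => (Set.toFinite (K i : Set F)).toFinset) f hf
      (fun i => by rw [hcard]; exact ha i)
    simp only [hcard] at this
    rw [heprod, ← hw, hammingNorm_evalX]
    exact this
  obtain ⟨σ, hσ⟩ := exists_perm_of_prod_le hDmono κ (c := c) (by omega) (by omega) (e := e)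
    (fun _ => rfl) (fun i => D i - a i) (fun i => by have := ha i; omega) (fun i => Nat.sub_le _ _)
    (by
      have : ∑ i, (D i - a i) + ∑ i, a i = ∑ i, D i := by
        rw [← Finset.sum_add_distrib]
        exact Finset.sum_congr rfl fun i _ => by have := ha i; omega
      omega) hfoot
  have hσhi : ∀ x, κ < x → D (σ x) - a (σ x) = D x := fun x hx => by
    rw [hσ x]; simp [e, hx.ne', hx.not_gt]
  have hσκ : D (σ κ) - a (σ κ) = c := by rw [hσ κ]; simp [e]
  have hσlo : ∀ x, x < κ → D (σ x) - a (σ x) = 1 := fun x hx => by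
    rw [hσ x]; simp [e, hx]
  obtain ⟨t, htle, htD, htmem, hσD⟩ := exists_orderEmb_of_le_perm hDmono hk σ
    (fun x hx => by have := hσhi x hx; omega)
  obtain ⟨j, hj⟩ := (htmem (σ κ)).2 ⟨κ, le_rfl, rfl⟩
  refine ⟨j, t, t.injective, fun i => hKeq _ _ (htle i) (htD i), ?_, a, ha_mem, ?_, ?_, ?_⟩
  · change c ≤ D (Fin.castLE hk j)
    rw [← htD j, hj, ← hσκ]
    exact Nat.sub_le _ _
  · change a (t j) = D (Fin.castLE hk j) - c
    rw [← htD j, hj]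
    have := ha (σ κ)
    omega
  · intro i hij
    change a (t i) = D (Fin.castLE hk i) - 1
    obtain ⟨x, hx, hxi⟩ := (htmem (t i)).1 ⟨i, rfl⟩
    have hxκ : x ≠ κ := by
      rintro rfl
      exact hij (t.injective (by rw [← hxi, hj]))
    rw [← htD i, ← hxi]
    have := hσlo x (lt_of_le_of_ne hx hxκ)
    have := ha (σ x)
    omega
  · intro w hw'
    obtain ⟨x, rfl⟩ := σ.surjective w
    have hx : κ < x := by
      by_contra! hle
      obtain ⟨i, hi⟩ := (htmem (σ x)).2 ⟨x, hle, rfl⟩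
      exact hw' i hi
    have := hσhi x hx
    have := hσD x hx
    have := ha (σ x)
    omega

end
end QACC
end

section
/- Let K_1 ⊆ K_2 ⊆ ⋯ ⊆ K_n ⊆ F_q be subfields of F_q with |K_i| = d_i, X = K_1 × ⋯ × K_n, and write d = ∑_{i=1}^k (d_i − 1) + ℓ with 0 ≤ k < n and 0 < ℓ ≤ d_{k+1} − 1. Then a codeword of C_X(d) has minimum weight if and only if it is of the form Ψ(f) where f ∈ F_q[X_1,…,X_n] has degree ≤ d and there exists g ∈ F_q[X_1,…,X_n] with f − g ∈ I_X and g X-equivalent to a polynomial h = σ · ∏_{i=1, i≠j}^{k+1} (X_i^{d_i−1} − 1) · ∏_{t=1}^{d_j − (d_{k+1}−ℓ)} (X_j − α_t), where j ∈ {1,…,k+1} satisfies d_j − (d_{k+1} − ℓ) ≥ 0, σ ∈ F_q \ {0}, and α_1,…,α_{d_j−(d_{k+1}−ℓ)} are distinct elements of K_j (the second product being 1 when d_j − (d_{k+1} − ℓ) = 0). -/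
namespace QACC

open MvPolynomial

noncomputable section

variable {F : Type} [Field F] [Fintype F] [DecidableEq F]

section

set_option linter.unusedSectionVars false

theorem prod_mul_sub_sum_le {n : ℕ} (m : ℕ) (q a : Fin n → ℕ) (hm : ∀ i, m ≤ q i)
    (ha : ∀ i, a i ≤ q i) :
    (m - ∑ i, a i) * ∏ i, q i ≤ m * ∏ i, (q i - a i) := by
  induction n with
  | zero => simp
  | succ n ih =>
    have h := ih (fun i => q i.succ) (fun i => a i.succ) (fun i => hm _) (fun i => ha _)
    rw [Fin.sum_univ_succ, Fin.prod_univ_succ, Fin.prod_univ_succ]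
    set s := ∑ i : Fin n, a i.succ
    set P := ∏ i : Fin n, q i.succ
    have h0 := hm 0
    have h1 := ha 0
    have key : (m - (a 0 + s)) * q 0 ≤ (q 0 - a 0) * (m - s) := by
      by_cases hle : a 0 + s ≤ m
      · obtain ⟨c, rfl⟩ := Nat.exists_eq_add_of_le hle
        obtain ⟨e, he⟩ := Nat.exists_eq_add_of_le h1
        rw [he, show a 0 + s + c - (a 0 + s) = c by omega, show a 0 + e - a 0 = e by omega,
          show a 0 + s + c - s = a 0 + c by omega]
        have : s + c ≤ e := by omega
        nlinarith [Nat.zero_le (a 0), Nat.mul_le_mul_left (a 0) (show c ≤ e by omega)]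
      · rw [show m - (a 0 + s) = 0 by omega]; simp
    calc (m - (a 0 + s)) * (q 0 * P) = ((m - (a 0 + s)) * q 0) * P := by ring
      _ ≤ ((q 0 - a 0) * (m - s)) * P := Nat.mul_le_mul_right _ key
      _ = (q 0 - a 0) * ((m - s) * P) := by ring
      _ ≤ (q 0 - a 0) * (m * ∏ i : Fin n, (q i.succ - a i.succ)) := Nat.mul_le_mul_left _ h
      _ = _ := by ring

theorem sum_Iio_succ {n : ℕ} (f : Fin (n + 1) → ℕ) (k : Fin n) :
    ∑ i ∈ Finset.Iio k.succ, f i = f 0 + ∑ i ∈ Finset.Iio k, f i.succ := by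
  have h1 : Finset.Iio k.succ = Finset.univ.filter (fun i => i < k.succ) := by ext; simp
  have h2 : Finset.Iio k = Finset.univ.filter (fun i => i < k) := by ext; simp
  rw [h1, h2, Finset.sum_filter, Finset.sum_filter, Fin.sum_univ_succ]
  simp

theorem Ioi_eq_cons {n : ℕ} (k k' : Fin n) (h : (k' : ℕ) = k + 1) :
    Finset.Ioi k = Finset.cons k' (Finset.Ioi k') (by simp) := by
  ext i
  simp only [Finset.mem_Ioi, Finset.mem_cons, Fin.lt_def, Fin.ext_iff]
  omega

theorem Iio_eq_cons {n : ℕ} (k k' : Fin n) (h : (k' : ℕ) = k + 1) :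
    Finset.Iio k' = Finset.cons k (Finset.Iio k) (by simp) := by
  ext i
  simp only [Finset.mem_Iio, Finset.mem_cons, Fin.lt_def, Fin.ext_iff]
  omega

theorem mul_prod_Ioi_le_prod_sub {n : ℕ} (q a : Fin n → ℕ) (hq : Monotone q)
    (ha : ∀ i, a i < q i) (k : Fin n) (l : ℕ) (hl : l < q k)
    (hsum : ∑ i, a i ≤ ∑ i ∈ Finset.Iio k, (q i - 1) + l) :
    (q k - l) * ∏ i ∈ Finset.Ioi k, q i ≤ ∏ i, (q i - a i) := by
  induction n generalizing l with
  | zero => exact k.elim0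
  | succ n ih =>
    induction k using Fin.cases with
    | zero =>
      have h := prod_mul_sub_sum_le (q 0) q a (fun i => hq (Fin.zero_le i)) (fun i => (ha i).le)
      have hs : ∑ i, a i ≤ l := by
        refine hsum.trans (le_of_eq ?_)
        rw [show Finset.Iio (0 : Fin (n + 1)) = ∅ by ext; simp]; simp
      have h0 : 0 < q 0 := (Nat.zero_le _).trans_lt (ha 0)
      rw [Fin.prod_Ioi_zero]
      rw [Fin.prod_univ_succ (f := q)] at h
      refine Nat.le_of_mul_le_mul_left (le_trans ?_ h) h0
      calc q 0 * ((q 0 - l) * ∏ j : Fin n, q j.succ)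
          = (q 0 - l) * (q 0 * ∏ j : Fin n, q j.succ) := by ring
        _ ≤ _ := Nat.mul_le_mul_right _ (by omega)
    | succ k =>
      rw [sum_Iio_succ, Fin.sum_univ_succ] at hsum
      rw [Fin.prod_Ioi_succ, Fin.prod_univ_succ]
      have hq' : Monotone (fun i : Fin n => q i.succ) :=
        fun i j h => hq (Fin.succ_le_succ_iff.mpr h)
      have ha' : ∀ i : Fin n, a i.succ < q i.succ := fun i => ha _
      have ha0 := ha 0
      obtain ⟨c, hc⟩ : ∃ c, q 0 - a 0 = c + 1 := ⟨q 0 - a 0 - 1, by omega⟩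
      have hqk : q 0 ≤ q k.succ := hq (Fin.zero_le _)
      rw [hc]
      by_cases h1 : l + c < q k.succ
      · have h := ih (fun i => q i.succ) (fun i => a i.succ) hq' ha' k (l + c) h1 (by
          omega)
        refine le_trans ?_ (Nat.mul_le_mul_left _ h)
        rw [← mul_assoc]
        refine Nat.mul_le_mul_right _ ?_
        obtain ⟨e, he⟩ : ∃ e, q k.succ = l + c + e + 1 := ⟨q k.succ - (l + c) - 1, by omega⟩
        rw [he, show l + c + e + 1 - l = c + e + 1 by omega,
          show l + c + e + 1 - (l + c) = e + 1 by omega]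
        nlinarith [Nat.zero_le (c * e)]
      · by_cases h2 : (k : ℕ) + 1 < n
        · set k' : Fin n := ⟨k + 1, h2⟩
          have hkk : k.succ ≤ k'.succ := by
            rw [Fin.succ_le_succ_iff, Fin.le_def]; simp [k']
          have hqk' : q k.succ ≤ q k'.succ := hq hkk
          have h := ih (fun i => q i.succ) (fun i => a i.succ) hq' ha' k' (l + c + 1 - q k.succ)
            (by omega) (by
              rw [Iio_eq_cons k k' rfl, Finset.sum_cons]; omega)
          refine le_trans ?_ (Nat.mul_le_mul_left _ h)
          rw [Ioi_eq_cons k k' rfl, Finset.prod_cons, ← mul_assoc, ← mul_assoc]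
          refine Nat.mul_le_mul_right _ ?_
          obtain ⟨e, he⟩ : ∃ e, q k.succ = l + e + 1 := ⟨q k.succ - l - 1, by omega⟩
          obtain ⟨r, hr⟩ : ∃ r, c = e + r := ⟨c - e, by omega⟩
          obtain ⟨t, ht⟩ : ∃ t, q k'.succ = e + r + 1 + t := ⟨q k'.succ - (c + 1), by omega⟩
          rw [show q k.succ - l = e + 1 by omega,
            show l + c + 1 - q k.succ = r by omega, ht, show e + r + 1 + t - r = e + 1 + t by omega,
            hr]
          nlinarith [Nat.zero_le (r * t)]
        · rw [show Finset.Ioi k = ∅ by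
            ext i; simp only [Finset.mem_Ioi, Fin.lt_def, Finset.notMem_empty, iff_false]; omega]
          have : 1 ≤ ∏ i : Fin n, (q i.succ - a i.succ) :=
            Finset.one_le_prod' (fun i _ => by have := ha' i; omega)
          rw [Finset.prod_empty, mul_one]
          exact le_trans (by omega) (Nat.le_mul_of_pos_right _ this)

theorem exists_reduced {n : ℕ} (S : Fin n → Finset F)
    (f : MvPolynomial (Fin n) F) :
    ∃ r : MvPolynomial (Fin n) F, r.totalDegree ≤ f.totalDegree ∧
      (∀ x : Fin n → F, (∀ i, x i ∈ S i) → eval x r = eval x f) ∧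
      ∀ c ∈ r.support, ∀ i, c i < (S i).card := by
  set P : Fin n → MvPolynomial (Fin n) F := fun i => ∏ r ∈ S i, (X i - C r) with hP
  have hmonic (i) : MonomialOrder.degLex.Monic (P i) :=
    MonomialOrder.Monic.prod (fun r _ => MonomialOrder.degLex.monic_X_sub_C i r)
  have hdeg (i) : MonomialOrder.degLex.degree (P i) = Finsupp.single i (S i).card := by
    simp only [P]
    rw [MonomialOrder.degree_prod_of_regular]
    · simp [Finset.sum_congr rfl (fun r _ ↦ MonomialOrder.degLex.degree_X_sub_C i r)]
    · intro r _
      rw [MonomialOrder.degLex.monic_X_sub_C]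
      exact isRegular_one
  obtain ⟨h, r, hf, hh, hr⟩ := MonomialOrder.degLex.div (b := P)
    (fun i => by simp only [(hmonic i).leadingCoeff_eq_one, isUnit_one]) f
  have hr' : r = f - Finsupp.linearCombination _ P h := by rw [hf]; ring
  refine ⟨r, ?_, ?_, ?_⟩
  · rw [hr']
    refine (totalDegree_sub _ _).trans (max_le le_rfl ?_)
    rw [Finsupp.linearCombination_apply, Finsupp.sum]
    refine totalDegree_finsetSum_le fun i _ => ?_
    rw [smul_eq_mul, mul_comm]
    exact degLex_totalDegree_monotone (hh i)
  · intro x hx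
    rw [hr', map_sub, sub_eq_self, Finsupp.linearCombination_apply, map_finsuppSum, Finsupp.sum]
    refine Finset.sum_eq_zero fun i _ => ?_
    rw [smul_eq_mul, map_mul]
    have : eval x (P i) = 0 := by
      rw [hP, map_prod]
      exact Finset.prod_eq_zero (hx i) (by simp)
    rw [this, mul_zero]
  · intro c hc i
    have := hr c hc i
    rw [hdeg, Finsupp.single_le_iff] at this
    omega

theorem exists_prod_sub_le_card {n : ℕ}
    (S : Fin n → Finset F) (f : MvPolynomial (Fin n) F) (x₀ : Fin n → F) (hx₀ : ∀ i, x₀ i ∈ S i)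
    (hf : eval x₀ f ≠ 0) :
    ∃ a : Fin n → ℕ, (∀ i, a i < (S i).card) ∧ ∑ i, a i ≤ f.totalDegree ∧
      ∏ i, ((S i).card - a i) ≤ ((Fintype.piFinset S).filter (fun x => eval x f ≠ 0)).card := by
  obtain ⟨r, hrd, hre, hrs⟩ := exists_reduced S f
  have hr0 : r ≠ 0 := by
    rintro rfl
    apply hf
    rw [← hre x₀ hx₀, map_zero]
  set a := MonomialOrder.degLex.degree r with ha
  have hmem : a ∈ r.support := MonomialOrder.degLex.degree_mem_support hr0
  refine ⟨a, hrs a hmem, ?_, ?_⟩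
  · refine le_trans (le_of_eq ?_) hrd
    rw [← degree_degLexDegree, ← ha, Finsupp.degree_eq_sum]
  by_contra! hlt
  set Z := (Fintype.piFinset S).filter (fun x => eval x f ≠ 0)
  set B : Finset (Fin n → ℕ) := Fintype.piFinset (fun i => Finset.range ((S i).card - a i)) with hB
  have hBc : B.card = ∏ i, ((S i).card - a i) := by simp [hB, Fintype.card_piFinset]
  let M : Matrix Z B F := fun x b => ∏ i, x.1 i ^ b.1 i
  have hker : LinearMap.ker M.mulVecLin ≠ ⊥ := by
    apply LinearMap.ker_ne_bot_of_finrank_lt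
    simp only [Module.finrank_fintype_fun_eq_card, Fintype.card_coe]
    omega
  obtain ⟨c, hc, hc0⟩ := (Submodule.ne_bot_iff _).mp hker
  set h : MvPolynomial (Fin n) F :=
    ∑ b : B, monomial (Finsupp.equivFunOnFinite.symm b.1) (c b) with hh
  have hcoef (b : B) : h.coeff (Finsupp.equivFunOnFinite.symm b.1) = c b := by
    rw [hh, coeff_sum, Finset.sum_eq_single b]
    · simp
    · intro b' _ hne
      rw [coeff_monomial, if_neg]
      intro heq
      exact hne (Subtype.ext (Finsupp.equivFunOnFinite.symm.injective heq))
    · simp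
  have hh0 : h ≠ 0 := by
    intro h0
    apply hc0
    funext b
    rw [← hcoef b, h0]; simp
  have hsupp : ∀ m ∈ h.support, ∀ i, m i < (S i).card - a i := by
    intro m hm i
    have hm' := support_sum hm
    simp only [Finset.mem_biUnion, Finset.mem_univ, true_and] at hm'
    obtain ⟨b, hb⟩ := hm'
    have := support_monomial_subset hb
    rw [Finset.mem_singleton] at this
    subst this
    have := Fintype.mem_piFinset.mp b.2 i
    simpa using this
  have heval (x : Z) : eval x.1 h = 0 := by
    have : M.mulVec c x = 0 := by
      have := LinearMap.mem_ker.mp hc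
      rw [Matrix.mulVecLin_apply] at this
      rw [this]; rfl
    rw [← this, hh, map_sum]
    simp only [Matrix.mulVec, dotProduct, M]
    refine Finset.sum_congr rfl fun b _ => ?_
    rw [eval_monomial, mul_comm, Finsupp.prod_fintype _ _ (by simp)]
    simp
  have hmul : MonomialOrder.degLex.degree (r * h) = a + MonomialOrder.degLex.degree h :=
    MonomialOrder.degree_mul hr0 hh0
  obtain ⟨s, hs, hs0⟩ := combinatorial_nullstellensatz_exists_eval_nonzero (r * h)
    (MonomialOrder.degLex.degree (r * h))
    (mem_support_iff.mp (MonomialOrder.degLex.degree_mem_support (mul_ne_zero hr0 hh0)))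
    (degree_degLexDegree).symm S (by
      intro i
      have := hsupp _ (MonomialOrder.degLex.degree_mem_support hh0) i
      rw [hmul, Finsupp.add_apply]
      omega)
  rw [map_mul, hre s hs] at hs0
  have hsZ : s ∈ Z := by
    simp only [Z, Finset.mem_filter, Fintype.mem_piFinset]
    exact ⟨hs, left_ne_zero_of_mul hs0⟩
  exact right_ne_zero_of_mul hs0 (heval ⟨s, hsZ⟩)

variable {n : ℕ} {K : Fin n → Subfield F}

/-- The points of the product of the subfields `K i`. -/
abbrev Pt (K : Fin n → Subfield F) : Type := cartPoint (fun i => (K i : Set F))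

/-- The code of order `d` on the product of the subfields `K i`. -/
abbrev code (K : Fin n → Subfield F) (d : ℕ) : Submodule F (Pt K → F) :=
  cartCode (fun i => (K i : Set F)) d

/-- The cardinality of the subfield `K i`. -/
abbrev size (K : Fin n → Subfield F) (i : Fin n) : ℕ := (K i : Set F).ncard

/-- The number of points of the product of the subfields of index larger than `k`. -/
abbrev tailCard (K : Fin n → Subfield F) (k : Fin n) : ℕ := ∏ i ∈ Finset.Ioi k, size K i

/-- The order of the code whose minimum distance is `δ * tailCard K k`. -/
abbrev order (K : Fin n → Subfield F) (k : Fin n) (δ : ℕ) : ℕ :=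
  ∑ i ∈ Finset.Iio k, (size K i - 1) + (size K k - δ)

/-- The elements of `K i`, as a finset. -/
def elems (K : Fin n → Subfield F) (i : Fin n) : Finset F := (Set.toFinite (K i : Set F)).toFinset

/-- The support of a word. -/
def supp (v : Pt K → F) : Finset (Pt K) := Finset.univ.filter (fun x => v x ≠ 0)

@[simp] theorem mem_elems (i : Fin n) (c : F) : c ∈ elems K i ↔ c ∈ K i := by
  simp [elems]

@[simp] theorem mem_supp (v : Pt K → F) (x : Pt K) : x ∈ supp v ↔ v x ≠ 0 := by
  simp [supp]

theorem card_elems (i : Fin n) : (elems K i).card = size K i :=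
  (Set.ncard_eq_toFinset_card _ _).symm

theorem two_le_size (i : Fin n) : 2 ≤ size K i := by
  rw [← card_elems]
  exact Finset.one_lt_card.mpr ⟨0, by simp [zero_mem], 1, by simp [one_mem], zero_ne_one⟩

theorem size_mono (hK : Monotone K) : Monotone (size K) := fun _ _ h =>
  Set.ncard_le_ncard (fun _ hx => hK h hx) (Set.toFinite _)

theorem field_eq_of_size_eq (hK : Monotone K) {i j : Fin n} (h : size K i = size K j) :
    K i = K j := by
  wlog hij : i ≤ j generalizing i j
  · exact (this h.symm (le_of_not_ge hij)).symm
  · exact SetLike.coe_injective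
      (Set.eq_of_subset_of_ncard_le (fun _ hx => hK hij hx) h.ge (Set.toFinite _))

theorem tailCard_pos (k : Fin n) : 0 < tailCard K k :=
  Finset.prod_pos fun i _ => by have := two_le_size (K := K) i; omega

theorem tailCard_succ {k k' : Fin n} (h : (k' : ℕ) = k + 1) :
    tailCard K k = size K k' * tailCard K k' := by
  rw [tailCard, Ioi_eq_cons k k' h, Finset.prod_cons]

theorem mem_code {d : ℕ} {v : Pt K → F} :
    v ∈ code K d ↔ ∃ f : MvPolynomial (Fin n) F, f.totalDegree ≤ d ∧
      evalX (fun i => (K i : Set F)) f = v := by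
  simp [code, cartCode, Submodule.mem_map, mem_restrictTotalDegree]

theorem mem_code_of_le {d e : ℕ} (h : d ≤ e) {v : Pt K → F} (hv : v ∈ code K d) :
    v ∈ code K e := by
  obtain ⟨f, hf, rfl⟩ := mem_code.mp hv
  exact mem_code.mpr ⟨f, hf.trans h, rfl⟩

theorem const_mem_code (d : ℕ) (c : F) : (fun _ => c : Pt K → F) ∈ code K d :=
  mem_code.mpr ⟨C c, by simp, by funext x; simp [evalX]⟩

theorem mul_mem_code {d e : ℕ} {u v : Pt K → F} (hu : u ∈ code K d) (hv : v ∈ code K e) :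
    (fun x => u x * v x) ∈ code K (d + e) := by
  obtain ⟨f, hf, rfl⟩ := mem_code.mp hu
  obtain ⟨g, hg, rfl⟩ := mem_code.mp hv
  exact mem_code.mpr ⟨f * g, (totalDegree_mul f g).trans (add_le_add hf hg),
    by funext x; simp [evalX]⟩

theorem prod_mem_code {ι : Type} (s : Finset ι) (d : ι → ℕ) (u : ι → Pt K → F)
    (hu : ∀ i ∈ s, u i ∈ code K (d i)) : (fun x => ∏ i ∈ s, u i x) ∈ code K (∑ i ∈ s, d i) := by
  classical
  induction s using Finset.induction_on with
  | empty => simpa using const_mem_code (K := K) 0 1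
  | insert a s ha ih =>
    simp only [Finset.prod_insert ha, Finset.sum_insert ha]
    exact mul_mem_code (hu a (by simp)) (ih fun i hi => hu i (by simp [hi]))

theorem pow_mem_code {d : ℕ} {u : Pt K → F} (hu : u ∈ code K d) (m : ℕ) :
    (fun x => u x ^ m) ∈ code K (m * d) := by
  simpa using prod_mem_code (Finset.range m) (fun _ => d) (fun _ => u) fun _ _ => hu

theorem sub_const_mem_code {d : ℕ} {u : Pt K → F} (hu : u ∈ code K d) (c : F) :
    (fun x => u x - c) ∈ code K d :=
  (code K d).sub_mem hu (const_mem_code d c)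

theorem card_box (φ : Equiv.Perm (Pt K)) (B : Fin n → Finset F) (hB : ∀ i, B i ⊆ elems K i) :
    (Finset.univ.filter (fun x : Pt K => ∀ i, (φ x).1 i ∈ B i)).card = ∏ i, (B i).card := by
  rw [← Fintype.card_piFinset]
  refine Finset.card_bij (fun x _ => (φ x).1) (fun x hx => ?_) (fun x _ y _ h => ?_)
    (fun y hy => ?_)
  · simpa [Fintype.mem_piFinset] using hx
  · exact φ.injective (Subtype.ext h)
  · have hy' := Fintype.mem_piFinset.mp hy
    refine ⟨φ.symm ⟨y, fun i => ?_⟩, ?_, ?_⟩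
    · exact (mem_elems i _).mp (hB i (hy' i))
    · simpa using hy'
    · simp

theorem le_card_supp (hK : Monotone K) {d : ℕ} {v : Pt K → F} (hv : v ∈ code K d)
    (hv0 : (supp v).Nonempty) (k : Fin n) (δ : ℕ) (hδ0 : 0 < δ) (hδ : δ ≤ size K k)
    (hd : d ≤ order K k δ) : δ * tailCard K k ≤ (supp v).card := by
  obtain ⟨f, hf, rfl⟩ := mem_code.mp hv
  obtain ⟨x₀, hx₀⟩ := hv0
  obtain ⟨a, ha, hsum, hprod⟩ := exists_prod_sub_le_card (elems K) f x₀.1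
    (fun i => (mem_elems i _).mpr (x₀.2 i)) (by simpa [evalX] using hx₀)
  simp only [card_elems] at ha hprod
  have h := mul_prod_Ioi_le_prod_sub (size K) a (size_mono hK) ha k (size K k - δ) (by omega)
    (hsum.trans (hf.trans hd))
  rw [show size K k - (size K k - δ) = δ by omega] at h
  refine h.trans (hprod.trans (le_of_eq (Eq.symm ?_)))
  refine Finset.card_bij (fun x _ => x.1) (fun x hx => ?_) (fun x _ y _ h => Subtype.ext h)
    (fun y hy => ?_)
  · have hx' := (mem_supp _ _).mp hx
    simp only [Finset.mem_filter, Fintype.mem_piFinset, mem_elems]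
    exact ⟨x.2, hx'⟩
  · simp only [Finset.mem_filter, Fintype.mem_piFinset, mem_elems] at hy
    exact ⟨⟨y, hy.1⟩, (mem_supp _ _).mpr hy.2, rfl⟩

/-- The word `v * ∏ (u - c')`, over the values `c' ≠ c` taken by `u` on the support of `v`, is
supported on the slice `u = c` of the support of `v`. -/
theorem exists_slice {d : ℕ} {v u : Pt K → F} (hv : v ∈ code K d) (hu : u ∈ code K 1) {c : F}
    (hc : c ∈ (supp v).image u) :
    ∃ w ∈ code K (d + (((supp v).image u).card - 1)),
      supp w = (supp v).filter (fun x => u x = c) := by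
  refine ⟨fun x => v x * ∏ c' ∈ ((supp v).image u).erase c, (u x - c'), mul_mem_code hv ?_, ?_⟩
  · rw [← Finset.card_erase_of_mem hc, Finset.card_eq_sum_ones]
    exact prod_mem_code _ (fun _ => 1) (fun c' x => u x - c') fun c' _ => sub_const_mem_code hu c'
  · ext x
    simp only [mem_supp, Finset.mem_filter, mul_ne_zero_iff, Finset.prod_ne_zero_iff,
      Finset.mem_erase, sub_ne_zero]
    refine and_congr_right fun hx => ⟨fun h => ?_, ?_⟩
    · by_contra hne
      exact h (u x) ⟨hne, Finset.mem_image_of_mem u ((mem_supp _ _).mpr hx)⟩ rfl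
    · rintro rfl c' hc' h
      exact hc'.1 h.symm

/-- The slices of the support of a word of minimum weight by the values of a function of degree
one with values in a subfield that is not larger than `K k`. -/
theorem slice_trichotomy (hK : Monotone K) {k i : Fin n} {δ : ℕ} (hδ0 : 0 < δ) (hδ : δ < size K k)
    {v u : Pt K → F} (hv : v ∈ code K (order K k δ)) (hcard : (supp v).card = δ * tailCard K k)
    (hu : u ∈ code K 1) (huK : ∀ x, u x ∈ K i) (hik : size K i ≤ size K k) :
    (∃ c, ∀ x ∈ supp v, u x = c) ∨
    (((supp v).image u).card = δ ∧ ∀ c ∈ (supp v).image u,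
      ((supp v).filter (fun x => u x = c)).card = tailCard K k) ∨
    ∃ k' : Fin n, (k' : ℕ) = k + 1 ∧ size K k' = size K k ∧ size K i = size K k ∧
      ((supp v).image u).card = size K k ∧ ∀ c ∈ (supp v).image u,
      ((supp v).filter (fun x => u x = c)).card = δ * tailCard K k' := by
  set M := (supp v).image u with hM
  have hN := tailCard_pos (K := K) k
  have hsum : ∑ c ∈ M, ((supp v).filter (fun x => u x = c)).card = δ * tailCard K k := by
    rw [← hcard]
    exact (Finset.card_eq_sum_card_fiberwise
      fun x hx => Finset.mem_coe.mpr (Finset.mem_image_of_mem u hx)).symm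
  have hMi : M.card ≤ size K i := by
    rw [← card_elems]
    refine Finset.card_le_card fun c hc => ?_
    obtain ⟨x, _, rfl⟩ := Finset.mem_image.mp hc
    exact (mem_elems _ _).mpr (huK x)
  have hM0 : 0 < M.card := by
    have : 0 < (supp v).card := by rw [hcard]; positivity
    exact Finset.card_pos.mpr ((Finset.card_pos.mp this).image u)
  have hne : ∀ c ∈ M, ((supp v).filter (fun x => u x = c)).Nonempty := by
    intro c hc
    obtain ⟨x, hx, rfl⟩ := Finset.mem_image.mp hc
    exact ⟨x, by simpa using hx⟩
  have hall (s : ℕ) (hs : ∀ c ∈ M, s ≤ ((supp v).filter (fun x => u x = c)).card)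
      (hms : M.card * s = δ * tailCard K k) :
      ∀ c ∈ M, ((supp v).filter (fun x => u x = c)).card = s := by
    have := (Finset.sum_eq_sum_iff_of_le hs).mp (by rw [hsum, Finset.sum_const, smul_eq_mul, hms])
    exact fun c hc => (this c hc).symm
  have hle (s : ℕ) (hs : ∀ c ∈ M, s ≤ ((supp v).filter (fun x => u x = c)).card) :
      M.card * s ≤ δ * tailCard K k := by
    rw [← hsum, ← smul_eq_mul]
    exact Finset.card_nsmul_le_sum _ _ _ hs
  have hord : order K k δ = ∑ i ∈ Finset.Iio k, (size K i - 1) + (size K k - δ) := rfl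
  by_cases hmδ : M.card ≤ δ
  · obtain ⟨r, hr⟩ := Nat.exists_eq_add_of_le hmδ
    have hs : ∀ c ∈ M, (r + 1) * tailCard K k ≤ ((supp v).filter (fun x => u x = c)).card := by
      intro c hc
      obtain ⟨w, hw, hws⟩ := exists_slice hv hu hc
      rw [← hws]
      refine le_card_supp hK hw (hws ▸ hne c hc) k (r + 1) (by omega) (by omega) ?_
      simp only [order, ← hM]
      omega
    have h1 := hle _ hs
    rw [← mul_assoc] at h1
    have h2 := Nat.le_of_mul_le_mul_right h1 hN
    by_cases hm1 : M.card = 1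
    · left
      obtain ⟨c, hc⟩ := Finset.card_eq_one.mp hm1
      refine ⟨c, fun x hx => ?_⟩
      have := Finset.mem_image_of_mem u hx
      rw [← hM, hc] at this
      exact Finset.mem_singleton.mp this
    · right; left
      have hr0 : r = 0 := by
        by_contra hr0
        obtain ⟨p, hp⟩ : ∃ p, M.card = p + 2 := ⟨M.card - 2, by omega⟩
        rw [hr, hp] at h2
        have : 0 < r := Nat.pos_of_ne_zero hr0
        nlinarith [Nat.zero_le (p * r)]
      subst hr0
      have hmδ' : M.card = δ := by omega
      refine ⟨hmδ', ?_⟩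
      simpa using hall _ hs (by rw [hmδ']; ring)
  · right; right
    by_cases hk : (k : ℕ) + 1 < n
    · set k' : Fin n := ⟨k + 1, hk⟩
      have hkk : size K k ≤ size K k' := size_mono hK (by rw [Fin.le_def]; simp [k'])
      have hN' := tailCard_pos (K := K) k'
      have htail := tailCard_succ (K := K) (k := k) (k' := k') rfl
      obtain ⟨r, hr⟩ := Nat.exists_eq_add_of_le (show M.card ≤ size K k' by omega)
      have hs : ∀ c ∈ M, (r + δ) * tailCard K k' ≤
          ((supp v).filter (fun x => u x = c)).card := by
        intro c hc
        obtain ⟨w, hw, hws⟩ := exists_slice hv hu hc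
        rw [← hws]
        refine le_card_supp hK hw (hws ▸ hne c hc) k' (r + δ) (by omega) (by omega) ?_
        simp only [order, ← hM]
        rw [Iio_eq_cons k k' rfl, Finset.sum_cons]
        omega
      have h1 := hle _ hs
      rw [htail, ← mul_assoc, ← mul_assoc] at h1
      have h2 := Nat.le_of_mul_le_mul_right h1 hN'
      have hr0 : r = 0 := by
        by_contra hr0
        have : 0 < r := Nat.pos_of_ne_zero hr0
        rw [hr] at h2
        nlinarith
      subst hr0
      refine ⟨k', rfl, by omega, by omega, by omega, ?_⟩
      have := hall _ hs (by rw [htail, hr]; ring)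
      simpa using this
    · exfalso
      have hI : Finset.Ioi k = ∅ := by
        ext i; simp only [Finset.mem_Ioi, Fin.lt_def, Finset.notMem_empty, iff_false]; omega
      have h1 := hle 1 fun c hc => Finset.card_pos.mpr (hne c hc)
      rw [tailCard, hI] at h1
      simp at h1
      omega

/-- Functions on the points that are given by an affine functional. -/
def IsAffineFun (u : Pt K → F) : Prop :=
  ∃ (a : Fin n → F) (b : F), ∀ x, u x = a ⬝ᵥ x.1 + b

/-- Permutations of the points that are given by an affine map. -/
def IsAffinePerm (φ : Equiv.Perm (Pt K)) : Prop :=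
  ∀ i, IsAffineFun fun x => (φ x).1 i

theorem IsAffineFun.add_mul {u v : Pt K → F} (hu : IsAffineFun u) (hv : IsAffineFun v) (c : F) :
    IsAffineFun fun x => u x + c * v x := by
  obtain ⟨a, b, h⟩ := hu
  obtain ⟨a', b', h'⟩ := hv
  refine ⟨a + c • a', b + c * b', fun x => ?_⟩
  simp only [h, h', add_dotProduct, smul_dotProduct, smul_eq_mul]
  ring

theorem IsAffineFun.const (c : F) : IsAffineFun (K := K) fun _ => c :=
  ⟨0, c, fun x => by simp⟩

theorem IsAffineFun.mem_code {u : Pt K → F} (hu : IsAffineFun u) : u ∈ code K 1 := by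
  obtain ⟨a, b, h⟩ := hu
  refine QACC.mem_code.mpr ⟨∑ i, C (a i) * X i + C b, ?_, ?_⟩
  · refine (totalDegree_add _ _).trans (max_le (totalDegree_finsetSum_le fun i _ => ?_) (by simp))
    exact (totalDegree_mul _ _).trans (by simp)
  · funext x
    simp [evalX, h, dotProduct]

theorem IsAffinePerm.refl : IsAffinePerm (Equiv.refl (Pt K)) := fun i =>
  ⟨Pi.single i 1, 0, fun x => by simp⟩

theorem exists_affinePerm (N : Fin n → Pt K → F) (hN : ∀ i, IsAffineFun (N i))
    (hK : ∀ i x, N i x ∈ K i) (hinj : ∀ x y, (∀ i, N i x = N i y) → x = y) :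
    ∃ φ : Equiv.Perm (Pt K), IsAffinePerm φ ∧ ∀ x i, (φ x).1 i = N i x := by
  have hbij : Function.Bijective (fun x => (⟨fun i => N i x, fun i => hK i x⟩ : Pt K)) :=
    Finite.injective_iff_bijective.mp fun x y h =>
      hinj x y fun i => congrFun (congrArg Subtype.val h) i
  exact ⟨Equiv.ofBijective _ hbij, fun i => hN i, fun x i => rfl⟩

theorem IsAffinePerm.exists_shear {φ : Equiv.Perm (Pt K)} (hφ : IsAffinePerm φ) (j : Fin n)
    (c : Fin n → F) (hj : c j = 0) (hc : ∀ i, c i ∈ K i) (hcK : ∀ i, c i ≠ 0 → K j ≤ K i) :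
    ∃ φ' : Equiv.Perm (Pt K), IsAffinePerm φ' ∧
      ∀ x i, (φ' x).1 i = (φ x).1 i + c i * (φ x).1 j := by
  refine exists_affinePerm (fun i x => (φ x).1 i + c i * (φ x).1 j)
    (fun i => (hφ i).add_mul (hφ j) _) (fun i x => ?_) (fun x y h => ?_)
  · by_cases h0 : c i = 0
    · simpa [h0] using (φ x).2 i
    · exact add_mem ((φ x).2 i) (mul_mem (hc i) (hcK i h0 ((φ x).2 j)))
  · have hxj : (φ x).1 j = (φ y).1 j := by simpa [hj] using h j
    apply φ.injective
    apply Subtype.ext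
    funext i
    have := h i
    simp only [hxj] at this
    exact add_right_cancel this

theorem IsAffinePerm.exists_swap {φ : Equiv.Perm (Pt K)} (hφ : IsAffinePerm φ) {i j : Fin n}
    (h : K i = K j) : ∃ φ' : Equiv.Perm (Pt K), IsAffinePerm φ' ∧
      ∀ x w, (φ' x).1 w = (φ x).1 (Equiv.swap i j w) := by
  refine exists_affinePerm (fun w x => (φ x).1 (Equiv.swap i j w)) (fun w => hφ _)
    (fun w x => ?_) (fun x y hxy => ?_)
  · have hw : K (Equiv.swap i j w) = K w := by
      rw [Equiv.swap_apply_def]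
      split_ifs with h1 h2
      · rw [h1, h]
      · rw [h2, h]
      · rfl
    rw [← hw]
    exact (φ x).2 _
  · apply φ.injective
    apply Subtype.ext
    funext w
    have := hxy (Equiv.swap i j w)
    simpa using this

theorem IsAffinePerm.exists_sub {φ : Equiv.Perm (Pt K)} (hφ : IsAffinePerm φ) (c : Fin n → F)
    (hc : ∀ i, c i ∈ K i) : ∃ φ' : Equiv.Perm (Pt K), IsAffinePerm φ' ∧
      ∀ x i, (φ' x).1 i = (φ x).1 i - c i := by
  refine exists_affinePerm (fun i x => (φ x).1 i - c i) (fun i => ?_)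
    (fun i x => sub_mem ((φ x).2 i) (hc i)) (fun x y h => ?_)
  · simpa [sub_eq_add_neg] using (hφ i).add_mul (IsAffineFun.const (c i)) (-1)
  · apply φ.injective
    apply Subtype.ext
    funext i
    exact sub_left_injective (h i)

theorem prod_eq_mul_tailCard {k j : Fin n} (hj : j ≤ k) (c : Fin n → ℕ)
    (h1 : ∀ i ≤ k, i ≠ j → c i = 1) (h2 : ∀ i, k < i → c i = size K i) :
    ∏ i, c i = c j * tailCard K k := by
  have hu : (Finset.univ : Finset (Fin n)) = Finset.Iic k ∪ Finset.Ioi k := by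
    ext i; simpa using le_or_gt i k
  have hd : Disjoint (Finset.Iic k) (Finset.Ioi k) :=
    Finset.disjoint_left.mpr fun i hi hi' => by
      rw [Finset.mem_Iic] at hi; rw [Finset.mem_Ioi] at hi'; exact absurd hi (not_le.mpr hi')
  rw [hu, Finset.prod_union hd]
  congr 1
  · exact Finset.prod_eq_single_of_mem j (by simpa using hj) fun i hi hij =>
      h1 i (by simpa using hi) hij
  · exact Finset.prod_congr rfl fun i hi => h2 i (by simpa using hi)

/-- The set of points whose coordinates of index at most `k`, other than the one of index `j`, are
`c`, and whose coordinate of index `j` lies in `T`, after the permutation `φ`. -/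
def stdSet (φ : Equiv.Perm (Pt K)) (k j : Fin n) (c : Fin n → F) (T : Finset F) :
    Finset (Pt K) :=
  Finset.univ.filter fun x => (φ x).1 j ∈ T ∧ ∀ i ≤ k, i ≠ j → (φ x).1 i = c i

@[simp] theorem mem_stdSet {φ : Equiv.Perm (Pt K)} {k j : Fin n} {c : Fin n → F} {T : Finset F}
    {x : Pt K} : x ∈ stdSet φ k j c T ↔
      (φ x).1 j ∈ T ∧ ∀ i ≤ k, i ≠ j → (φ x).1 i = c i := by
  simp [stdSet]

theorem card_stdSet (φ : Equiv.Perm (Pt K)) {k j : Fin n} (hj : j ≤ k) {c : Fin n → F}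
    {T : Finset F} (hc : ∀ i, c i ∈ K i) (hT : T ⊆ elems K j) :
    (stdSet φ k j c T).card = T.card * tailCard K k := by
  set B : Fin n → Finset F := fun i => if i = j then T else if i ≤ k then {c i} else elems K i
    with hB
  have hBj : B j = T := by simp [hB]
  have hB1 : ∀ i ≤ k, i ≠ j → B i = {c i} := fun i hi hij => by simp [hB, hi, hij]
  have hB2 : ∀ i, k < i → B i = elems K i := fun i hi => by
    simp [hB, (hj.trans_lt hi).ne', not_le.mpr hi]
  have hBK : ∀ i, B i ⊆ elems K i := by
    intro i
    by_cases hij : i = j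
    · rw [hij, hBj]; exact hT
    · by_cases hik : i ≤ k
      · rw [hB1 i hik hij]; simpa using hc i
      · rw [hB2 i (not_le.mp hik)]
  have h := card_box φ B hBK
  rw [prod_eq_mul_tailCard hj _ (fun i hi hij => by simp [hB1 i hi hij])
    (fun i hi => by rw [hB2 i hi, card_elems]), hBj] at h
  rw [← h]
  congr 1
  ext x
  simp only [mem_stdSet, Finset.mem_filter, Finset.mem_univ, true_and]
  constructor
  · rintro ⟨h1, h2⟩ i
    by_cases hij : i = j
    · rw [hij, hBj]; exact h1
    · by_cases hik : i ≤ k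
      · rw [hB1 i hik hij]; simpa using h2 i hik hij
      · rw [hB2 i (not_le.mp hik)]; simpa using (φ x).2 i
  · refine fun h => ⟨hBj ▸ h j, fun i hi hij => ?_⟩
    have := h i
    rw [hB1 i hi hij] at this
    simpa using this

theorem mem_stdSet_singleton {φ : Equiv.Perm (Pt K)} {k j : Fin n} (hj : j ≤ k) {c : Fin n → F}
    {x : Pt K} : x ∈ stdSet φ k j c {c j} ↔ ∀ i ≤ k, (φ x).1 i = c i := by
  rw [mem_stdSet, Finset.mem_singleton]
  constructor
  · rintro ⟨h1, h2⟩ i hi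
    by_cases hij : i = j
    · rw [hij, h1]
    · exact h2 i hi hij
  · exact fun h => ⟨h j hj, fun i hi _ => h i hi⟩

/-- A set of `e * tailCard K k` points is standard at level `k`. -/
def IsStdSet (k : Fin n) (e : ℕ) (S : Finset (Pt K)) : Prop :=
  ∃ φ : Equiv.Perm (Pt K), IsAffinePerm φ ∧ ∃ j ≤ k, ∃ c : Fin n → F, (∀ i, c i ∈ K i) ∧
    ∃ T ⊆ elems K j, T.card = e ∧ S = stdSet φ k j c T

/-- A set of points with constant coordinates, except one with few values, is standard as soon as
it is large enough. -/
theorem isStdSet_of_const {φ : Equiv.Perm (Pt K)} (hφ : IsAffinePerm φ) {k j : Fin n} (hj : j ≤ k)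
    {e : ℕ} {S : Finset (Pt K)} (hS : S.card = e * tailCard K k)
    (hne : S.Nonempty) (hconst : ∀ i ≤ k, i ≠ j → ∃ c, ∀ x ∈ S, (φ x).1 i = c)
    (he : (S.image fun x => (φ x).1 j).card = e) : IsStdSet k e S := by
  obtain ⟨x₀, hx₀⟩ := hne
  have hT : S.image (fun x => (φ x).1 j) ⊆ elems K j := by
    intro c hc
    obtain ⟨x, _, rfl⟩ := Finset.mem_image.mp hc
    exact (mem_elems _ _).mpr ((φ x).2 j)
  refine ⟨φ, hφ, j, hj, (φ x₀).1, (φ x₀).2, _, hT, he, ?_⟩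
  refine Finset.eq_of_subset_of_card_le (fun x hx => mem_stdSet.mpr
    ⟨Finset.mem_image_of_mem _ hx, fun i hi hij => ?_⟩) ?_
  · obtain ⟨c, hc⟩ := hconst i hi hij
    rw [hc x hx, hc x₀ hx₀]
  · rw [card_stdSet φ hj (φ x₀).2 hT, he, hS]

/-- A set that contains a flat, such that every coordinate which is constant on the flat is either
constant on the set or cuts it into `e` slices of the size of the flat, is standard. -/
theorem isStdSet_of_flat (hK : Monotone K) {φ : Equiv.Perm (Pt K)} (hφ : IsAffinePerm φ)
    {k : Fin n} {e : ℕ} (he : 1 < e) {S : Finset (Pt K)} (hS : S.card = e * tailCard K k)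
    {c : Fin n → F} (hc : ∀ i, c i ∈ K i) (hZ : ∀ x, (∀ i ≤ k, (φ x).1 i = c i) → x ∈ S)
    (H : ∀ ψ : Equiv.Perm (Pt K), IsAffinePerm ψ → ∀ i ≤ k, ∀ b : F,
      (∀ x, (∀ i ≤ k, (φ x).1 i = c i) → (ψ x).1 i = b) →
      (∃ b, ∀ x ∈ S, (ψ x).1 i = b) ∨ (S.image fun x => (ψ x).1 i).card = e ∧
        ∀ b ∈ S.image fun x => (ψ x).1 i,
          (S.filter fun x => (ψ x).1 i = b).card = tailCard K k) :
    IsStdSet k e S := by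
  classical
  have hN := tailCard_pos (K := K) k
  set Z := stdSet φ k k c {c k} with hZdef
  have hmemZ (x : Pt K) : x ∈ Z ↔ ∀ i ≤ k, (φ x).1 i = c i := mem_stdSet_singleton le_rfl
  have hZc : Z.card = tailCard K k := by
    rw [hZdef, card_stdSet φ le_rfl hc (by simpa using hc k)]; simp
  obtain ⟨z, hz⟩ : Z.Nonempty := Finset.card_pos.mp (by omega)
  have hzS := hZ z ((hmemZ z).mp hz)
  have hex : ∃ i, i ≤ k ∧ ∃ x ∈ S, (φ x).1 i ≠ c i := by
    by_contra! hcon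
    have : S ⊆ Z := fun x hx => (hmemZ x).mpr fun i hi => hcon i hi x hx
    have := Finset.card_le_card this
    rw [hZc, hS] at this
    nlinarith
  obtain ⟨j, ⟨hjk, x₀, hx₀, hx₀j⟩, hmin⟩ :
      ∃ j, (j ≤ k ∧ ∃ x ∈ S, (φ x).1 j ≠ c j) ∧
        ∀ i < j, ¬ (i ≤ k ∧ ∃ x ∈ S, (φ x).1 i ≠ c i) := by
    obtain ⟨j, hj, hmin⟩ := WellFounded.has_min (wellFounded_lt (α := Fin n))
      {i | i ≤ k ∧ ∃ x ∈ S, (φ x).1 i ≠ c i} hex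
    exact ⟨j, hj, fun i hij hi => hmin i hi hij⟩
  have hne : (φ x₀).1 j - c j ≠ 0 := sub_ne_zero.mpr hx₀j
  set l : Fin n → F := fun i =>
    if j < i ∧ i ≤ k then (c i - (φ x₀).1 i) / ((φ x₀).1 j - c j) else 0 with hl
  obtain ⟨ψ, hψ, hψx⟩ := hφ.exists_shear j l (by simp [hl]) (fun i => by
      simp only [hl]
      split_ifs with h
      · exact div_mem (sub_mem (hc i) ((φ x₀).2 i))
          (sub_mem (hK h.1.le ((φ x₀).2 j)) (hK h.1.le (hc j)))
      · exact zero_mem _) (fun i hi => by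
      simp only [hl] at hi
      split_ifs at hi with h
      · exact hK h.1.le
      · exact absurd rfl hi)
  have hψj : ∀ x, (ψ x).1 j = (φ x).1 j := fun x => by rw [hψx]; simp [hl]
  refine isStdSet_of_const hψ hjk hS ⟨z, hzS⟩ (fun i hik hij => ?_) ?_
  · rcases lt_or_gt_of_ne hij with hlt | hgt
    · refine ⟨c i, fun x hx => ?_⟩
      rw [hψx]
      have h1 : l i = 0 := by simp [hl, hlt.le]
      have h2 := hmin i hlt
      push Not at h2
      simp [h1, h2 hik x hx]
    · have hb : ∀ x, (∀ i ≤ k, (φ x).1 i = c i) → (ψ x).1 i = c i + l i * c j := by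
        intro x hx
        rw [hψx, hx i hik, hx j hjk]
      rcases H ψ hψ i hik _ hb with h | ⟨_, h⟩
      · exact h
      · exfalso
        have hx₀i : (ψ x₀).1 i = c i + l i * c j := by
          have hli : l i = (c i - (φ x₀).1 i) / ((φ x₀).1 j - c j) := by simp [hl, hgt, hik]
          rw [hψx, hli]
          field_simp
          ring
        have hcard := h _ (Finset.mem_image.mpr ⟨x₀, hx₀, hx₀i⟩)
        have hsub : insert x₀ Z ⊆ S.filter fun x => (ψ x).1 i = c i + l i * c j := by
          intro x hx
          rw [Finset.mem_filter]
          rcases Finset.mem_insert.mp hx with rfl | hx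
          · exact ⟨hx₀, hx₀i⟩
          · have := (hmemZ x).mp hx
            exact ⟨hZ x this, hb x this⟩
        have hle := Finset.card_le_card hsub
        rw [Finset.card_insert_of_notMem fun h => hx₀j ((hmemZ x₀).mp h j hjk), hcard, hZc] at hle
        omega
  · rcases H φ hφ j hjk (c j) (fun x hx => hx j hjk) with ⟨b, hb⟩ | ⟨h, _⟩
    · exact absurd ((hb x₀ hx₀).trans ((hb z hzS).symm.trans ((hmemZ z).mp hz j hjk))) hx₀j
    · simpa only [hψj] using h

theorem exists_flat_of_const {φ : Equiv.Perm (Pt K)} (hφ : IsAffinePerm φ) {k : Fin n}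
    {S : Finset (Pt K)} (hS : S.card = tailCard K k)
    (hconst : ∀ i ≤ k, ∃ c, ∀ x ∈ S, (φ x).1 i = c) :
    ∃ φ : Equiv.Perm (Pt K), IsAffinePerm φ ∧ ∃ c : Fin n → F, (∀ i, c i ∈ K i) ∧
      ∀ x, x ∈ S ↔ ∀ i ≤ k, (φ x).1 i = c i := by
  have hN := tailCard_pos (K := K) k
  obtain ⟨x₀, hx₀⟩ : S.Nonempty := Finset.card_pos.mp (by omega)
  refine ⟨φ, hφ, (φ x₀).1, (φ x₀).2, fun x => ?_⟩
  rw [← mem_stdSet_singleton (le_refl k)]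
  refine Finset.ext_iff.mp (Finset.eq_of_subset_of_card_le (fun x hx => ?_) ?_) x
  · rw [mem_stdSet_singleton le_rfl]
    intro i hi
    obtain ⟨c, hc⟩ := hconst i hi
    rw [hc x hx, hc x₀ hx₀]
  · rw [card_stdSet φ le_rfl (φ x₀).2 (by simpa using (φ x₀).2 k), hS]; simp

/-- The words of minimum weight whose support is a flat. -/
theorem exists_flat (hK : Monotone K) (k : Fin n) {v : Pt K → F} (hv : v ∈ code K (order K k 1))
    (hcard : (supp v).card = tailCard K k) :
    ∃ φ : Equiv.Perm (Pt K), IsAffinePerm φ ∧ ∃ c : Fin n → F, (∀ i, c i ∈ K i) ∧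
      ∀ x, x ∈ supp v ↔ ∀ i ≤ k, (φ x).1 i = c i := by
  induction hr : n - (k : ℕ) generalizing k v with
  | zero => omega
  | succ r ih =>
    have hk2 := two_le_size (K := K) k
    have htri {ψ : Equiv.Perm (Pt K)} (hψ : IsAffinePerm ψ) {i : Fin n}
        (hi : size K i ≤ size K k) := slice_trichotomy hK one_pos hk2 hv (by rw [one_mul, hcard])
          (hψ i).mem_code (fun x => (ψ x).2 i) hi
    have hone {u : Pt K → F} (h : ((supp v).image u).card = 1) :
        ∃ c, ∀ x ∈ supp v, u x = c := by
      obtain ⟨c, hc⟩ := Finset.card_eq_one.mp h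
      refine ⟨c, fun x hx => ?_⟩
      have := Finset.mem_image_of_mem u hx
      rw [hc] at this
      exact Finset.mem_singleton.mp this
    by_cases hall : ∀ i ≤ k, ∃ c, ∀ x ∈ supp v, x.1 i = c
    · exact exists_flat_of_const IsAffinePerm.refl hcard hall
    push Not at hall
    obtain ⟨i, hi, hnc⟩ := hall
    rcases htri IsAffinePerm.refl (size_mono hK hi) with ⟨c, hc⟩ | ⟨h, _⟩ |
        ⟨k', hk', hkk, _, himg, hsl⟩
    · obtain ⟨x, hx, hne⟩ := hnc c
      exact absurd (hc x hx) hne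
    · obtain ⟨c, hc⟩ := hone h
      obtain ⟨x, hx, hne⟩ := hnc c
      exact absurd (hc x hx) hne
    obtain ⟨x₀, hx₀, -⟩ := hnc 0
    have hb : (x₀.1 i) ∈ (supp v).image (fun x => x.1 i) := Finset.mem_image_of_mem _ hx₀
    obtain ⟨w, hw, hws⟩ := exists_slice hv (IsAffinePerm.refl i).mem_code hb
    have hw' : w ∈ code K (order K k' 1) := by
      refine mem_code_of_le ?_ hw
      simp only [Equiv.refl_apply] at himg ⊢
      rw [himg]
      simp only [order]
      rw [Iio_eq_cons k k' hk', Finset.sum_cons]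
      omega
    obtain ⟨φ, hφ, c, hc, hZ⟩ := ih k' hw' (by rw [hws]; simpa using hsl _ hb) (by omega)
    have hstd : IsStdSet k' (size K k) (supp v) := by
      refine isStdSet_of_flat hK hφ hk2 ?_ hc (fun x hx => ?_) (fun ψ hψ i hi b _ => ?_)
      · rw [hcard, tailCard_succ hk', hkk]
      · have := (hZ x).mpr hx
        rw [hws] at this
        exact (Finset.mem_filter.mp this).1
      · rcases htri hψ (i := i) (hkk ▸ size_mono hK hi) with h | ⟨h, _⟩ | ⟨k'', hk'', _, _, h1, h2⟩
        · exact Or.inl h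
        · exact Or.inl (hone h)
        · obtain rfl : k'' = k' := Fin.ext (by omega)
          exact Or.inr ⟨h1, by simpa using h2⟩
    obtain ⟨θ, hθ, j, hj, d, hd, T, hT, hTc, hS⟩ := hstd
    have hjk : size K j = size K k' := by
      refine le_antisymm (size_mono hK hj) ?_
      rw [hkk, ← hTc, ← card_elems]
      exact Finset.card_le_card hT
    obtain ⟨θ', hθ', hx'⟩ := hθ.exists_swap (field_eq_of_size_eq hK hjk)
    refine exists_flat_of_const hθ' hcard fun w hw => ⟨d (Equiv.swap j k' w), fun x hx => ?_⟩
    rw [hS, mem_stdSet] at hx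
    rw [hx']
    have hwk : w ≠ k' := by
      rintro rfl
      rw [Fin.le_def] at hw
      omega
    refine hx.2 _ ?_ ?_
    · rw [Equiv.swap_apply_def]
      split_ifs
      · exact le_rfl
      · rw [Fin.le_def] at hw ⊢; omega
    · intro h
      rw [Equiv.swap_apply_eq_iff, Equiv.swap_apply_left] at h
      exact hwk h

/-- A word of minimum weight that is cut into `δ` slices by some coordinate has standard support. -/
theorem isStdSet_of_slices (hK : Monotone K) {k : Fin n} {δ : ℕ} (hδ0 : 1 < δ)
    (hδ : δ < size K k) {v : Pt K → F} (hv : v ∈ code K (order K k δ))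
    (hcard : (supp v).card = δ * tailCard K k) {u : Pt K → F} (hu : u ∈ code K 1)
    (himg : ((supp v).image u).card = δ)
    (hsl : ∀ c ∈ (supp v).image u, ((supp v).filter (fun x => u x = c)).card = tailCard K k) :
    IsStdSet k δ (supp v) := by
  obtain ⟨b, hb⟩ : ((supp v).image u).Nonempty := Finset.card_pos.mp (by omega)
  obtain ⟨w, hw, hws⟩ := exists_slice hv hu hb
  have hw' : w ∈ code K (order K k 1) := by
    refine mem_code_of_le ?_ hw
    rw [himg]
    simp only [order]
    omega
  have hwc : (supp w).card = tailCard K k := by rw [hws, hsl b hb]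
  obtain ⟨φ, hφ, c, hc, hZ⟩ := exists_flat hK k hw' hwc
  have hsub : ∀ x ∈ supp w, x ∈ supp v := fun x hx => by
    rw [hws] at hx
    exact (Finset.mem_filter.mp hx).1
  refine isStdSet_of_flat hK hφ hδ0 hcard hc (fun x hx => hsub x ((hZ x).mpr hx))
    (fun ψ hψ i hi b hb => ?_)
  rcases slice_trichotomy hK (by omega) hδ hv hcard (hψ i).mem_code (fun x => (ψ x).2 i)
    (size_mono hK hi) with h | h | ⟨k', hk', hkk, _, _, h2⟩
  · exact Or.inl h
  · exact Or.inr h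
  · exfalso
    have hN := tailCard_pos (K := K) k'
    have htail := tailCard_succ (K := K) hk'
    obtain ⟨z, hz⟩ : (supp w).Nonempty := Finset.card_pos.mp (by
      rw [hwc]; exact tailCard_pos k)
    have hle : supp w ⊆ (supp v).filter fun x => (ψ x).1 i = b := fun x hx =>
      Finset.mem_filter.mpr ⟨hsub x hx, hb x ((hZ x).mp hx)⟩
    have hle' := Finset.card_le_card hle
    rw [h2 b (Finset.mem_image.mpr ⟨z, hsub z hz, hb z ((hZ z).mp hz)⟩), hwc, htail, hkk] at hle'
    have := Nat.le_of_mul_le_mul_right hle' hN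
    omega

set_option maxHeartbeats 1000000 in
/-- The words of minimum weight whose support is not a flat. -/
theorem isStdSet_supp (hK : Monotone K) (k : Fin n) {δ : ℕ} (hδ0 : 1 < δ) (hδ : δ < size K k)
    {v : Pt K → F} (hv : v ∈ code K (order K k δ)) (hcard : (supp v).card = δ * tailCard K k) :
    IsStdSet k δ (supp v) := by
  classical
  induction hr : n - (k : ℕ) generalizing k v with
  | zero => omega
  | succ r ih =>
    have hN := tailCard_pos (K := K) k
    by_cases hA : ∃ ψ : Equiv.Perm (Pt K), IsAffinePerm ψ ∧ ∃ i,
        ((supp v).image fun x => (ψ x).1 i).card = δ ∧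
        ∀ c ∈ (supp v).image fun x => (ψ x).1 i,
          ((supp v).filter (fun x => (ψ x).1 i = c)).card = tailCard K k
    · obtain ⟨ψ, hψ, i, h1, h2⟩ := hA
      exact isStdSet_of_slices hK hδ0 hδ hv hcard (hψ i).mem_code h1 h2
    exfalso
    have hdi {ψ : Equiv.Perm (Pt K)} (hψ : IsAffinePerm ψ) {i : Fin n}
        (hi : size K i ≤ size K k) :
        (∃ c, ∀ x ∈ supp v, (ψ x).1 i = c) ∨
        ∃ k' : Fin n, (k' : ℕ) = k + 1 ∧ size K k' = size K k ∧ size K i = size K k ∧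
          ((supp v).image fun x => (ψ x).1 i).card = size K k ∧
          ∀ c ∈ (supp v).image fun x => (ψ x).1 i,
            ((supp v).filter (fun x => (ψ x).1 i = c)).card = δ * tailCard K k' := by
      rcases slice_trichotomy hK (by omega) hδ hv hcard (hψ i).mem_code (fun x => (ψ x).2 i) hi
        with h | h | h
      · exact Or.inl h
      · exact absurd ⟨ψ, hψ, i, h⟩ hA
      · exact Or.inr h
    obtain ⟨x₀, hx₀⟩ : (supp v).Nonempty := Finset.card_pos.mp (by rw [hcard]; positivity)
    obtain ⟨i, hi, hnc⟩ : ∃ i ≤ k, ¬ ∃ c, ∀ x ∈ supp v, x.1 i = c := by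
      by_contra! hall
      have hsub : supp v ⊆ stdSet (Equiv.refl _) k k x₀.1 {x₀.1 k} := fun x hx => by
        rw [mem_stdSet_singleton le_rfl]
        intro i hi
        obtain ⟨c, hc⟩ := hall i hi
        exact (hc x hx).trans (hc x₀ hx₀).symm
      have := Finset.card_le_card hsub
      rw [card_stdSet _ le_rfl x₀.2 (by simpa using x₀.2 k), hcard, Finset.card_singleton] at this
      nlinarith
    rcases hdi IsAffinePerm.refl (size_mono hK hi) with h | ⟨k', hk', hkk, _, himg, hsl⟩
    · exact hnc h
    have hN' := tailCard_pos (K := K) k'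
    have htail := tailCard_succ (K := K) hk'
    have hb : (x₀.1 i) ∈ (supp v).image (fun x => x.1 i) := Finset.mem_image_of_mem _ hx₀
    obtain ⟨w, hw, hws⟩ := exists_slice hv (IsAffinePerm.refl i).mem_code hb
    have hw' : w ∈ code K (order K k' δ) := by
      refine mem_code_of_le ?_ hw
      simp only [Equiv.refl_apply] at himg ⊢
      rw [himg]
      simp only [order]
      rw [Iio_eq_cons k k' hk', Finset.sum_cons]
      omega
    have hwc : (supp w).card = δ * tailCard K k' := by rw [hws]; exact hsl _ hb
    obtain ⟨φ, hφ, j, hj, c, hc, T, hT, hTc, hS⟩ :=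
      ih k' (hkk ▸ hδ) hw' hwc (by omega)
    have hsub : ∀ x ∈ supp w, x ∈ supp v := fun x hx => by
      rw [hws] at hx
      exact (Finset.mem_filter.mp hx).1
    have hdi' {ψ : Equiv.Perm (Pt K)} (hψ : IsAffinePerm ψ) {i : Fin n} (hi : i ≤ k')
        (hnc : ¬ ∃ c, ∀ x ∈ supp v, (ψ x).1 i = c) : size K i = size K k ∧
          ((supp v).image fun x => (ψ x).1 i).card = size K k ∧
          ∀ c ∈ (supp v).image fun x => (ψ x).1 i,
            ((supp v).filter (fun x => (ψ x).1 i = c)).card = δ * tailCard K k' := by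
      rcases hdi hψ (i := i) (hkk ▸ size_mono hK hi) with h | ⟨k'', hk'', _, h1, h2, h3⟩
      · exact absurd h hnc
      · obtain rfl : k'' = k' := Fin.ext (by omega)
        exact ⟨h1, h2, h3⟩
    obtain ⟨t₁, ht₁, t₂, ht₂, hne⟩ := Finset.one_lt_card.mp (hTc ▸ hδ0)
    have hpt (t : F) (ht : t ∈ T) : ∃ z ∈ supp w, (φ z).1 j = t := by
      have hz : ∀ i, Function.update c j t i ∈ K i := fun i => by
        rw [Function.update_apply]
        split_ifs with h
        · rw [h]
          exact (mem_elems _ _).mp (hT ht)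
        · exact hc i
      refine ⟨φ.symm ⟨Function.update c j t, hz⟩, ?_, by simp⟩
      rw [hS, mem_stdSet]
      simp only [Equiv.apply_symm_apply, Function.update_self]
      exact ⟨ht, fun i _ hij => by simp [hij]⟩
    obtain ⟨z₁, hz₁, hz₁j⟩ := hpt t₁ ht₁
    obtain ⟨z₂, hz₂, hz₂j⟩ := hpt t₂ ht₂
    obtain ⟨hjs, -, -⟩ := hdi' hφ hj (by
      rintro ⟨b, hb⟩
      exact hne (by rw [← hz₁j, ← hz₂j, hb _ (hsub _ hz₁), hb _ (hsub _ hz₂)]))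
    obtain ⟨i, hi, hij, hnci⟩ : ∃ i ≤ k', i ≠ j ∧ ¬ ∃ c, ∀ x ∈ supp v, (φ x).1 i = c := by
      by_contra! hall
      have hsub : supp v ⊆ stdSet φ k' j (φ x₀).1 (elems K j) := fun x hx => by
        rw [mem_stdSet]
        refine ⟨by simpa using (φ x).2 j, fun i hi hij => ?_⟩
        obtain ⟨c, hc⟩ := hall i hi hij
        exact (hc x hx).trans (hc x₀ hx₀).symm
      have := Finset.card_le_card hsub
      rw [card_stdSet _ hj (φ x₀).2 subset_rfl, hcard, card_elems, hjs, ← hkk, ← htail] at this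
      nlinarith
    obtain ⟨his, -, hisl⟩ := hdi' hφ hi hnci
    have hKij : K i = K j := field_eq_of_size_eq hK (his.trans hjs.symm)
    have hwi : ∀ z ∈ supp w, (φ z).1 i = c i := fun z hz => by
      rw [hS, mem_stdSet] at hz
      exact hz.2 i hi hij
    have hZ : supp w = (supp v).filter fun x => (φ x).1 i = c i := by
      refine Finset.eq_of_subset_of_card_le
        (fun x hx => Finset.mem_filter.mpr ⟨hsub x hx, hwi x hx⟩) ?_
      rw [hwc, hisl _ (Finset.mem_image.mpr ⟨z₁, hsub z₁ hz₁, hwi z₁ hz₁⟩)]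
    obtain ⟨t, ht, htT⟩ : ∃ t ∈ elems K j, t ∉ T :=
      Finset.exists_mem_notMem_of_card_lt_card (by rw [hTc, card_elems, hjs]; exact hδ)
    -- the slices by the lines through the point `(c i, t)` that are not in direction `j`
    let D : F → Finset (Pt K) := fun l =>
      (supp v).filter fun x => (φ x).1 j + l * (φ x).1 i = t + l * c i
    have hDc : ∀ l ∈ elems K j, (D l).card = δ * tailCard K k' := by
      intro l hl
      rw [mem_elems] at hl
      obtain ⟨ψ, hψ, hψx⟩ := hφ.exists_shear i (Pi.single j l) (by simp [hij]) (fun a => by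
          by_cases ha : a = j
          · subst ha; simpa using hl
          · simp [ha, zero_mem]) (fun a ha => by
          by_cases haj : a = j
          · rw [haj, hKij]
          · simp [haj] at ha)
      have hψj : ∀ x, (ψ x).1 j = (φ x).1 j + l * (φ x).1 i := fun x => by
        rw [hψx]; simp
      obtain ⟨-, h2, h3⟩ := hdi' hψ hj (by
        rintro ⟨b, hb⟩
        have e1 := hb _ (hsub _ hz₁)
        have e2 := hb _ (hsub _ hz₂)
        rw [hψj, hz₁j, hwi _ hz₁] at e1
        rw [hψj, hz₂j, hwi _ hz₂] at e2
        exact hne (add_right_cancel (e1.trans e2.symm)))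
      simp only [hψj] at h2 h3
      refine h3 _ ?_
      have himg : ((supp v).image fun x => (φ x).1 j + l * (φ x).1 i) = elems K j := by
        refine Finset.eq_of_subset_of_card_le (fun b hb => ?_) (by rw [h2, card_elems, hjs])
        obtain ⟨x, _, rfl⟩ := Finset.mem_image.mp hb
        rw [mem_elems, ← hψj]
        exact (ψ x).2 j
      rw [himg, mem_elems]
      exact add_mem ((mem_elems _ _).mp ht) (mul_mem hl (hKij ▸ hc i))
    have hDi : ∀ l, ∀ x ∈ D l, (φ x).1 i ≠ c i := by
      intro l x hx hxi
      obtain ⟨hxv, hxl⟩ := Finset.mem_filter.mp hx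
      have hxw : x ∈ supp w := by
        rw [hZ]
        exact Finset.mem_filter.mpr ⟨hxv, hxi⟩
      rw [hS, mem_stdSet] at hxw
      rw [hxi] at hxl
      exact htT (add_right_cancel hxl ▸ hxw.1)
    have hdisj : ((elems K j : Finset F) : Set F).PairwiseDisjoint D := by
      intro l _ l' _ hll
      refine Finset.disjoint_left.mpr fun x hx hx' => ?_
      have h1 := (Finset.mem_filter.mp hx).2
      have h2 := (Finset.mem_filter.mp hx').2
      have h3 : (l - l') * ((φ x).1 i - c i) = 0 := by linear_combination h1 - h2
      rcases mul_eq_zero.mp h3 with h | h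
      · exact hll (sub_eq_zero.mp h)
      · exact hDi l x hx (sub_eq_zero.mp h)
    have hunion : (elems K j).biUnion D ⊆ supp v \ supp w := by
      intro x hx
      obtain ⟨l, _, hxl⟩ := Finset.mem_biUnion.mp hx
      exact Finset.mem_sdiff.mpr ⟨(Finset.mem_filter.mp hxl).1, fun h => hDi l x hxl (hwi x h)⟩
    have hle := Finset.card_le_card hunion
    rw [Finset.card_biUnion hdisj, Finset.sum_congr rfl hDc, Finset.sum_const, card_elems, hjs,
      Finset.card_sdiff_of_subset hsub, hcard, hwc, htail, hkk, smul_eq_mul] at hle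
    have hpos : 0 < δ * tailCard K k' := by positivity
    have heq : δ * (size K k * tailCard K k') = size K k * (δ * tailCard K k') := by ring
    have h2 := two_le_size (K := K) k
    have : δ * tailCard K k' ≤ size K k * (δ * tailCard K k') := Nat.le_mul_of_pos_left _ (by omega)
    omega

/-- The support of a word of minimum weight is standard. -/
theorem isStdSet_supp_of_card (hK : Monotone K) (k : Fin n) {δ : ℕ} (hδ0 : 0 < δ)
    (hδ : δ < size K k) {v : Pt K → F} (hv : v ∈ code K (order K k δ))
    (hcard : (supp v).card = δ * tailCard K k) : IsStdSet k δ (supp v) := by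
  rcases Nat.lt_or_ge 1 δ with h | h
  · exact isStdSet_supp hK k h hδ hv hcard
  · obtain rfl : δ = 1 := by omega
    obtain ⟨φ, hφ, c, hc, hS⟩ := exists_flat hK k hv (by rw [hcard, one_mul])
    exact ⟨φ, hφ, k, le_rfl, c, hc, {c k}, by simpa using hc k, by simp, by
      ext x; rw [mem_stdSet_singleton le_rfl, hS]⟩

/-- The value at `x` of the polynomial
`σ ∏_{i ≤ k, i ≠ j} (X_i ^ (size K i - 1) - 1) ∏_t (X_j - α t)` composed with `φ`. -/
def stdWord (φ : Equiv.Perm (Pt K)) (k j : Fin n) {m : ℕ} (α : Fin m → F) (σ : F) : Pt K → F :=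
  fun x => σ * (∏ i ∈ Finset.univ.filter (fun i : Fin n => (i : ℕ) ≤ k ∧ i ≠ j),
    ((φ x).1 i ^ (size K i - 1) - 1)) * ∏ t, ((φ x).1 j - α t)

theorem pow_size_sub_one_sub_one_ne_zero {i : Fin n} {y : F} (hy : y ∈ K i) :
    y ^ (size K i - 1) - 1 ≠ 0 ↔ y = 0 := by
  have h2 := two_le_size (K := K) i
  constructor
  · intro h
    by_contra hy0
    refine h (sub_eq_zero.mpr ?_)
    have : Fintype (K i) := Fintype.ofFinite _
    have hcard : size K i = Fintype.card (K i) := by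
      rw [← Nat.card_eq_fintype_card]
      rfl
    have := FiniteField.pow_card_sub_one_eq_one (⟨y, hy⟩ : K i)
      (fun h => hy0 (congrArg Subtype.val h))
    rw [hcard]
    exact congrArg Subtype.val this
  · rintro rfl
    rw [zero_pow (by omega)]
    simp

theorem supp_stdWord (φ : Equiv.Perm (Pt K)) (k j : Fin n) {m : ℕ} (α : Fin m → F) {σ : F}
    (hσ : σ ≠ 0) :
    supp (stdWord φ k j α σ) = stdSet φ k j 0 (elems K j \ Finset.univ.image α) := by
  ext x
  have hj : (φ x).1 j ∈ K j := (φ x).2 j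
  rw [mem_supp, mem_stdSet, stdWord, mul_ne_zero_iff, mul_ne_zero_iff, Finset.prod_ne_zero_iff,
    Finset.prod_ne_zero_iff, Finset.mem_sdiff, mem_elems]
  have h1 : (∀ i ∈ Finset.univ.filter (fun i : Fin n => (i : ℕ) ≤ k ∧ i ≠ j),
      (φ x).1 i ^ (size K i - 1) - 1 ≠ 0) ↔ ∀ i ≤ k, i ≠ j → (φ x).1 i = (0 : Fin n → F) i := by
    simp only [Finset.mem_filter, Finset.mem_univ, true_and, and_imp, Pi.zero_apply, Fin.le_def]
    exact forall₃_congr fun i _ _ => pow_size_sub_one_sub_one_ne_zero ((φ x).2 i)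
  have h2 : (∀ t ∈ Finset.univ, (φ x).1 j - α t ≠ 0) ↔ (φ x).1 j ∉ Finset.univ.image α := by
    simp [sub_eq_zero, @eq_comm _ ((φ x).1 j)]
  rw [h1, h2]
  tauto

theorem stdWord_mem_code {φ : Equiv.Perm (Pt K)} (hφ : IsAffinePerm φ) {k j : Fin n} (hj : j ≤ k)
    {m δ : ℕ} (hδ0 : 0 < δ) (hδ : δ ≤ size K k) (hm : m + δ = size K j) (α : Fin m → F) (σ : F) :
    stdWord φ k j α σ ∈ code K (order K k δ) := by
  have hpow (i : Fin n) : (fun x => (φ x).1 i ^ (size K i - 1)) ∈ code K (size K i - 1) :=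
    mem_code_of_le (mul_one _).le (pow_mem_code (hφ i).mem_code (size K i - 1))
  have h1 := prod_mem_code (Finset.univ.filter (fun i : Fin n => (i : ℕ) ≤ k ∧ i ≠ j))
    (fun i => size K i - 1) (fun i x => (φ x).1 i ^ (size K i - 1) - 1) fun i _ =>
      sub_const_mem_code (hpow i) 1
  have h2 := prod_mem_code (Finset.univ : Finset (Fin m)) (fun _ => 1)
    (fun t x => (φ x).1 j - α t) fun t _ => sub_const_mem_code (hφ j).mem_code _
  refine mem_code_of_le ?_ (mul_mem_code (mul_mem_code (const_mem_code 0 σ) h1) h2)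
  have e1 : ∑ i ∈ Finset.Iic k, (size K i - 1) = ∑ i ∈ Finset.Iio k, (size K i - 1)
      + (size K k - 1) := by
    rw [← Finset.Iio_insert k, Finset.sum_insert (by simp), add_comm]
  have e2 : Finset.univ.filter (fun i : Fin n => (i : ℕ) ≤ k ∧ i ≠ j) = (Finset.Iic k).erase j := by
    ext i
    rw [Finset.mem_filter_univ, Finset.mem_erase, Finset.mem_Iic, Fin.le_def, and_comm]
  have e3 := Finset.sum_erase_add (Finset.Iic k) (fun i => size K i - 1) (Finset.mem_Iic.mpr hj)
  rw [e2]
  simp only [Finset.sum_const, Finset.card_univ, Fintype.card_fin, smul_eq_mul, mul_one, order]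
  omega

theorem card_supp_stdWord (φ : Equiv.Perm (Pt K)) {k j : Fin n} (hj : j ≤ k) {m δ : ℕ}
    (hm : m + δ = size K j) {α : Fin m → F} (hα : Function.Injective α) (hαK : ∀ t, α t ∈ K j)
    {σ : F} (hσ : σ ≠ 0) : (supp (stdWord φ k j α σ)).card = δ * tailCard K k := by
  have hsub : Finset.univ.image α ⊆ elems K j := fun y hy => by
    obtain ⟨t, -, rfl⟩ := Finset.mem_image.mp hy
    exact (mem_elems _ _).mpr (hαK t)
  rw [supp_stdWord φ k j α hσ, card_stdSet φ hj (c := 0) (fun i => zero_mem _) Finset.sdiff_subset,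
    Finset.card_sdiff_of_subset hsub, Finset.card_image_of_injective _ hα, card_elems,
    Finset.card_univ, Fintype.card_fin]
  congr 1
  omega

theorem hammingNorm_eq_card_supp (v : Pt K → F) : hammingNorm v = (supp v).card := by
  rw [hammingNorm, supp]

theorem supp_nonempty {v : Pt K → F} : (supp v).Nonempty ↔ v ≠ 0 := by
  rw [Function.ne_iff]
  exact exists_congr fun x => mem_supp v x

/-- Every set of elements of `K j` is the complement of the range of an injective family. -/
theorem exists_enum {j : Fin n} {T : Finset F} (hT : T ⊆ elems K j) {m : ℕ}
    (hm : m + T.card = size K j) : ∃ α : Fin m → F, Function.Injective α ∧ (∀ t, α t ∈ K j) ∧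
      elems K j \ Finset.univ.image α = T := by
  have hc : (elems K j \ T).card = m := by
    rw [Finset.card_sdiff_of_subset hT, card_elems]
    omega
  let e := (Finset.equivFinOfCardEq hc).symm
  have himg : Finset.univ.image (fun t => (e t : F)) = elems K j \ T := by
    ext y
    simp only [Finset.mem_image, Finset.mem_univ, true_and]
    exact ⟨fun ⟨t, ht⟩ => ht ▸ (e t).2, fun h => ⟨e.symm ⟨y, h⟩, by simp⟩⟩
  refine ⟨fun t => e t, fun a b h => e.injective (Subtype.ext h), fun t => ?_, ?_⟩
  · exact (mem_elems _ _).mp (Finset.mem_sdiff.mp (e t).2).1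
  · rw [himg, Finset.sdiff_sdiff_eq_self hT]

theorem minDist_code (hK : Monotone K) (k : Fin n) {δ : ℕ} (hδ0 : 0 < δ) (hδ : δ ≤ size K k) :
    minDist (code K (order K k δ)) = δ * tailCard K k := by
  have hm : size K k - δ + δ = size K k := by omega
  obtain ⟨T, hT, hTc⟩ := Finset.exists_subset_card_eq (hδ.trans (card_elems (K := K) k).ge)
  obtain ⟨α, hα, hαK, -⟩ := exists_enum hT (by rw [hTc]; exact hm)
  have hcard := card_supp_stdWord (Equiv.refl (Pt K)) le_rfl hm hα hαK (one_ne_zero (α := F))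
  have hpos : 0 < δ * tailCard K k := Nat.mul_pos hδ0 (tailCard_pos k)
  refine (IsLeast.csInf_eq ⟨⟨_, stdWord_mem_code IsAffinePerm.refl le_rfl hδ0 hδ hm α 1, ?_,
    (hammingNorm_eq_card_supp _).trans hcard⟩, ?_⟩)
  · exact supp_nonempty.mp (Finset.card_pos.mp (by omega))
  · rintro w ⟨v, hv, hv0, rfl⟩
    rw [hammingNorm_eq_card_supp]
    exact le_card_supp hK hv (supp_nonempty.mpr hv0) k δ hδ0 hδ le_rfl

/-- A word of minimum weight is determined by its support, up to a nonzero factor. -/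
theorem exists_eq_stdWord (hK : Monotone K) (k : Fin n) {δ : ℕ} (hδ0 : 0 < δ)
    (hδ : δ < size K k) {v : Pt K → F} (hv : v ∈ code K (order K k δ))
    (hcard : (supp v).card = δ * tailCard K k) :
    ∃ φ : Equiv.Perm (Pt K), IsAffinePerm φ ∧ ∃ j ≤ k, δ ≤ size K j ∧
      ∃ α : Fin (size K j - δ) → F, Function.Injective α ∧ (∀ t, α t ∈ K j) ∧
        ∃ σ ≠ 0, v = stdWord φ k j α σ := by
  obtain ⟨φ, hφ, j, hj, c, hc, T, hT, hTc, hS⟩ := isStdSet_supp_of_card hK k hδ0 hδ hv hcard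
  have hδj : δ ≤ size K j := by
    rw [← hTc, ← card_elems]
    exact Finset.card_le_card hT
  have hm : size K j - δ + δ = size K j := by omega
  obtain ⟨φ', hφ', hx'⟩ := hφ.exists_sub (fun i => if i = j then 0 else c i) fun i => by
    split_ifs
    · exact zero_mem _
    · exact hc i
  obtain ⟨α, hα, hαK, hαT⟩ := exists_enum hT (m := size K j - δ) (by omega)
  have hS' (τ : F) (hτ : τ ≠ 0) : supp (stdWord φ' k j α τ) = supp v := by
    rw [supp_stdWord φ' k j α hτ, hαT, hS]
    ext x
    simp only [mem_stdSet, hx', if_true, sub_zero, Pi.zero_apply]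
    refine and_congr_right fun _ => forall₃_congr fun i _ hij => ?_
    rw [if_neg hij, sub_eq_zero]
  obtain ⟨x₀, hx₀⟩ : (supp v).Nonempty :=
    Finset.card_pos.mp (by rw [hcard]; exact Nat.mul_pos hδ0 (tailCard_pos k))
  set h := stdWord φ' k j α 1 with hh
  have hhx₀ : h x₀ ≠ 0 := by
    rw [← mem_supp, hS' 1 one_ne_zero]
    exact hx₀
  have hscale (τ : F) : stdWord φ' k j α τ = τ • h := by
    funext x
    simp [hh, stdWord, mul_assoc]
  refine ⟨φ', hφ', j, hj, hδj, α, hα, hαK, v x₀ / h x₀,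
    div_ne_zero ((mem_supp _ _).mp hx₀) hhx₀, ?_⟩
  by_contra hne
  have hlt : (supp (v - stdWord φ' k j α (v x₀ / h x₀))).card < (supp v).card := by
    refine Finset.card_lt_card ⟨fun x hx => ?_, fun hsub => ?_⟩
    · rw [mem_supp] at hx ⊢
      intro hvx
      have : x ∉ supp (stdWord φ' k j α 1) := by rw [hS' 1 one_ne_zero, mem_supp]; simpa using hvx
      rw [mem_supp, not_not, ← hh] at this
      exact hx (by simp [hscale, hvx, this])
    · refine (mem_supp _ _).mp (hsub hx₀) ?_
      simp [hscale, hhx₀]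
  have hge := le_card_supp hK
    ((code K _).sub_mem hv (stdWord_mem_code hφ' hj hδ0 hδ.le hm α (v x₀ / h x₀)))
    (supp_nonempty.mpr (sub_ne_zero.mpr hne)) k δ hδ0 hδ.le le_rfl
  omega

theorem IsAffinePerm.exists_matrix {φ : Equiv.Perm (Pt K)} (hφ : IsAffinePerm φ) :
    ∃ (A : Matrix (Fin n) (Fin n) F) (b : Fin n → F), IsUnit A.det ∧
      (fun x => A.mulVec x + b) '' {x : Fin n → F | ∀ i, x i ∈ K i}
        = {x : Fin n → F | ∀ i, x i ∈ K i} ∧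
      ∀ x, (φ x).1 = A.mulVec x.1 + b := by
  choose a b hab using hφ
  have hφx : ∀ x, (φ x).1 = (Matrix.of a).mulVec x.1 + b := fun x => funext fun i => hab i x
  refine ⟨Matrix.of a, b, ?_, ?_, hφx⟩
  · rw [← Matrix.isUnit_iff_isUnit_det, ← Matrix.mulVec_surjective_iff_isUnit]
    have hmem : ∀ x : Pt K, x.1 - (⟨0, fun i => zero_mem _⟩ : Pt K).1 ∈
        LinearMap.range (Matrix.of a).mulVecLin := fun x => by
      refine ⟨(φ.symm x).1 - (φ.symm ⟨0, fun i => zero_mem _⟩).1, ?_⟩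
      have h1 := hφx (φ.symm x)
      have h2 := hφx (φ.symm ⟨0, fun i => zero_mem _⟩)
      rw [Equiv.apply_symm_apply] at h1 h2
      rw [h1, h2, map_sub, Matrix.mulVecLin_apply, Matrix.mulVecLin_apply]
      abel
    have htop : LinearMap.range (Matrix.of a).mulVecLin = ⊤ := by
      rw [eq_top_iff, ← (Pi.basisFun F (Fin n)).span_eq, Submodule.span_le]
      rintro _ ⟨i, rfl⟩
      have := hmem ⟨Pi.single i 1, fun w => by
        by_cases h : w = i
        · subst h; simp [one_mem]
        · simp [h, zero_mem]⟩
      simpa using this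
    exact LinearMap.range_eq_top.mp htop
  · ext y
    constructor
    · rintro ⟨x, hx, rfl⟩
      have := (φ ⟨x, hx⟩).2
      rw [hφx] at this
      exact this
    · intro hy
      refine ⟨(φ.symm ⟨y, hy⟩).1, (φ.symm ⟨y, hy⟩).2, ?_⟩
      exact (hφx _).symm.trans (by rw [Equiv.apply_symm_apply])

theorem exists_affinePerm_of_image_eq {A : Matrix (Fin n) (Fin n) F} {b : Fin n → F}
    (h : (fun x => A.mulVec x + b) '' {x : Fin n → F | ∀ i, x i ∈ K i}
      = {x : Fin n → F | ∀ i, x i ∈ K i}) :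
    ∃ φ : Equiv.Perm (Pt K), IsAffinePerm φ ∧ ∀ x, (φ x).1 = A.mulVec x.1 + b := by
  have hbij : Function.Bijective (fun x : Pt K => (⟨A.mulVec x.1 + b,
      h.subset ⟨x.1, x.2, rfl⟩⟩ : Pt K)) :=
    Finite.surjective_iff_bijective.mp fun y => by
      obtain ⟨x, hx, hxy⟩ := h.superset y.2
      exact ⟨⟨x, hx⟩, Subtype.ext hxy⟩
  exact ⟨Equiv.ofBijective _ hbij, fun i => ⟨A i, b i, fun x => rfl⟩, fun x => rfl⟩

theorem evalX_aeval_eq_stdWord {φ : Equiv.Perm (Pt K)} {A : Matrix (Fin n) (Fin n) F}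
    {b : Fin n → F} (hφ : ∀ x, (φ x).1 = A.mulVec x.1 + b) (k j : Fin n) {m : ℕ} (α : Fin m → F)
    (σ : F) :
    evalX (fun i => (K i : Set F)) (aeval
      (fun i : Fin n => (∑ w, C (A i w) * (X w : MvPolynomial (Fin n) F)) + C (b i))
      (C σ * (∏ i ∈ Finset.univ.filter (fun i : Fin n => (i : ℕ) ≤ k ∧ i ≠ j),
        ((X i : MvPolynomial (Fin n) F) ^ (size K i - 1) - 1)) *
        ∏ t, ((X j : MvPolynomial (Fin n) F) - C (α t)))) = stdWord φ k j α σ := by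
  funext x
  have hx (i : Fin n) : eval x.1 ((∑ w, C (A i w) * (X w : MvPolynomial (Fin n) F)) + C (b i))
      = (φ x).1 i := by
    rw [hφ]
    simp [Matrix.mulVec, dotProduct]
  simp only [evalX, LinearMap.coe_mk, AddHom.coe_mk, stdWord, map_mul, map_prod, map_sub, map_pow,
    map_one, aeval_X, hx, aeval_C, algebraMap_eq, eval_C]

end

/-- characterization of the minimal weight codewords of C_X(d) for a chain
of subfields K_1 ⊆ ⋯ ⊆ K_n: a codeword has minimal weight iff it is Ψ(f) with
deg f ≤ d, f - g ∈ I_X (i.e. Ψ(f - g) = 0) for some g which is X-equivalent (via an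
invertible affine map ψ : α ↦ Aα + b with ψ(X) = X, substituted into the variables) to
h = σ ∏_{i ≤ k+1, i ≠ j} (X_i^{d_i - 1} - 1) ∏_t (X_j - α_t) with σ ≠ 0, the α_t
distinct elements of K_j and d_j - (d_{k+1} - ℓ) ≥ 0.  (0-based indices.) -/
theorem minimal_weight_codewords_characterization
    (n : ℕ) (K : Fin n → Subfield F) (hmono : Monotone K)
    (d k ℓ : ℕ) (hk : k < n) (hℓ1 : 0 < ℓ) (hℓ2 : ℓ ≤ ((K ⟨k, hk⟩ : Set F)).ncard - 1)
    (hd : d = (∑ i ∈ Finset.univ.filter (fun i : Fin n => (i : ℕ) < k),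
        (((K i : Set F)).ncard - 1)) + ℓ) :
    ∀ v ∈ cartCode (fun i => (K i : Set F)) d,
      (v ≠ 0 ∧ hammingNorm v = minDist (cartCode (fun i => (K i : Set F)) d)) ↔
      ∃ f : MvPolynomial (Fin n) F, f.totalDegree ≤ d ∧
        evalX (fun i => (K i : Set F)) f = v ∧
        ∃ g : MvPolynomial (Fin n) F,
          evalX (fun i => (K i : Set F)) (f - g) = 0 ∧
          ∃ (σ : F) (_ : σ ≠ 0) (j : Fin n) (_ : (j : ℕ) ≤ k)
            (_ : ((K ⟨k, hk⟩ : Set F)).ncard - ℓ ≤ ((K j : Set F)).ncard)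
            (α : Fin (((K j : Set F)).ncard
                - (((K ⟨k, hk⟩ : Set F)).ncard - ℓ)) → F),
            Function.Injective α ∧ (∀ t, α t ∈ K j) ∧
            ∃ (A : Matrix (Fin n) (Fin n) F) (b : Fin n → F), IsUnit A.det ∧
              (fun x => A.mulVec x + b) '' {x : Fin n → F | ∀ i, x i ∈ K i}
                = {x : Fin n → F | ∀ i, x i ∈ K i} ∧
              g = MvPolynomial.aeval
                  (fun i : Fin n =>
                    (∑ w, C (A i w) * (X w : MvPolynomial (Fin n) F)) + C (b i))
                  (C σ *
                    (∏ i ∈ Finset.univ.filter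
                        (fun i : Fin n => (i : ℕ) ≤ k ∧ i ≠ j),
                      ((X i : MvPolynomial (Fin n) F) ^ (((K i : Set F)).ncard - 1) - 1)) *
                    ∏ t, ((X j : MvPolynomial (Fin n) F) - C (α t))) := by
  intro v hv
  set κ : Fin n := ⟨k, hk⟩ with hκ
  set δ := size K κ - ℓ with hδ
  have h2 := two_le_size (K := K) κ
  replace hℓ2 : ℓ ≤ size K κ - 1 := hℓ2
  have hℓ : size K κ - δ = ℓ := by omega
  have hδ0 : 0 < δ := by omega
  have hδlt : δ < size K κ := by omega
  have hdo : d = order K κ δ := by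
    have hfilter : Finset.univ.filter (fun i : Fin n => (i : ℕ) < k) = Finset.Iio κ := by
      ext i
      simp [hκ, Fin.lt_def]
    rw [hd, hfilter, order, hℓ]
  subst hdo
  rw [minDist_code hmono κ hδ0 hδlt.le, hammingNorm_eq_card_supp]
  constructor
  · rintro ⟨-, hcard⟩
    obtain ⟨f, hf, hfv⟩ := mem_code.mp hv
    obtain ⟨φ, hφ, j, hj, hδj, α, hα, hαK, σ, hσ, hvw⟩ :=
      exists_eq_stdWord hmono κ hδ0 hδlt hv hcard
    obtain ⟨A, b, hA, himg, hAφ⟩ := hφ.exists_matrix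
    refine ⟨f, hf, hfv, _, ?_, σ, hσ, j, hj, hδj, α, hα, hαK, A, b, hA, himg, rfl⟩
    rw [map_sub, hfv, sub_eq_zero, hvw]
    exact (evalX_aeval_eq_stdWord hAφ κ j α σ).symm
  · rintro ⟨f, -, hfv, g, hfg, σ, hσ, j, hj, hδj, α, hα, hαK, A, b, -, himg, rfl⟩
    obtain ⟨φ, -, hAφ⟩ := exists_affinePerm_of_image_eq himg
    have hvw : v = stdWord φ κ j α σ := by
      rw [map_sub, hfv, sub_eq_zero] at hfg
      exact hfg.trans (evalX_aeval_eq_stdWord hAφ κ j α σ)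
    have hcard : (supp v).card = δ * tailCard K κ := by
      rw [hvw]
      exact card_supp_stdWord φ hj (Nat.sub_add_cancel hδj) hα hαK hσ
    exact ⟨supp_nonempty.mp (Finset.card_pos.mp
      (by rw [hcard]; exact Nat.mul_pos hδ0 (tailCard_pos κ))), hcard⟩

end
end QACC
end
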